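/- arXiv:math/9702233 — 4 statements merged into one kernel-verified Lean document; each statement's English description precedes it below -/
import Mathlib

section
/- Let G be a finite group, N a nontrivial solvable normal subgroup of G, F = Fit(N) the Fitting subgroup of N, and m = max(cd(G|N)). Then m ∉ cd(G/F | N/F); consequently cd(G/F | N/F) is a proper subset of cd(G|N). -/
open CategoryTheory

/-- `cdOver G N` is `cd(G|N)`: the set of degrees `χ(1)` of irreducible complex characters
`χ` of `G` whose kernel does not contain `N`. -/
def cdOver (G : Type) [Group G] (N : Subgroup G) : Set ℕ :=
  { d | ∃ V : FDRep ℂ G, Simple V ∧ (¬ ∀ n ∈ N, V.character n = V.character 1) ∧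
        d = Module.finrank ℂ V }

/-- `cdOverRel G N F` is `cd(G/F | N/F)`, viewed via the canonical identification of
`Irr(G/F)` with the irreducible characters of `G` whose kernel contains `F`: it is the
set of degrees of irreducible characters of `G` containing `F` in their kernel but not
containing `N` in their kernel. -/
def cdOverRel (G : Type) [Group G] (N F : Subgroup G) : Set ℕ :=
  { d | ∃ V : FDRep ℂ G, Simple V ∧ (∀ g ∈ F, V.character g = V.character 1) ∧
        (¬ ∀ n ∈ N, V.character n = V.character 1) ∧ d = Module.finrank ℂ V }

/-- The Fitting subgroup of a group: the join of all nilpotent normal subgroups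
(for a finite group, the largest nilpotent normal subgroup). -/
def fittingSubgroup (H : Type) [Group H] : Subgroup H :=
  sSup { K : Subgroup H | K.Normal ∧ Group.IsNilpotent K }

instance fittingSubgroup_characteristic (H : Type) [Group H] :
    (fittingSubgroup H).Characteristic := by
  rw [Subgroup.characteristic_iff_map_le]
  intro φ
  rw [fittingSubgroup, (Subgroup.gc_map_comap φ.toMonoidHom).l_sSup]
  refine iSup₂_le fun K ⟨hK, hK'⟩ => le_sSup ⟨hK.map _ φ.surjective, ?_⟩
  exact Group.nilpotent_of_mulEquiv (K.equivMapOfInjective φ.toMonoidHom φ.injective)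

theorem le_map_fittingSubgroup {G : Type} [Group G] {N K : Subgroup G} (hKN : K ≤ N) [K.Normal]
    [Group.IsNilpotent K] : K ≤ (fittingSubgroup N).map N.subtype := by
  have h : K.subgroupOf N ≤ fittingSubgroup N :=
    le_sSup ⟨inferInstance, Group.nilpotent_of_mulEquiv (Subgroup.subgroupOfEquivOfLe hKN).symm⟩
  simpa [Subgroup.subgroupOf_map_subtype, inf_eq_left.2 hKN]
    using Subgroup.map_mono (f := N.subtype) h

theorem exists_normal_ne_bot_pow_eq_one {G : Type*} [Group G] [Finite G] (N : Subgroup G)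
    [N.Normal] [Group.IsSolvable N] (hN : N ≠ ⊥) :
    ∃ p : ℕ, p.Prime ∧ ∃ B : Subgroup G, B.Normal ∧ B ≠ ⊥ ∧ B ≤ N ∧ ∀ x ∈ B, x ^ p = 1 := by
  classical
  obtain ⟨D, hDn, hDN, hD, hcomm⟩ : ∃ D : Subgroup G, D.Normal ∧ D ≤ N ∧ D ≠ ⊥ ∧
      ∀ x ∈ D, ∀ y ∈ D, x * y = y * x := by
    have hex : ∃ n, derivedSeries N n = ⊥ := (Group.isSolvable_def N).1 inferInstance
    obtain ⟨k, hk⟩ : ∃ k, Nat.find hex = k + 1 := by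
      refine Nat.exists_eq_succ_of_ne_zero fun h => hN ?_
      have := Nat.find_spec hex
      rw [h, derivedSeries_zero] at this
      have hs := congrArg (Subgroup.map N.subtype) this
      rwa [← MonoidHom.range_eq_map, Subgroup.range_subtype, Subgroup.map_bot] at hs
    have h1 := Nat.find_spec hex
    have h2 : derivedSeries N k ≠ ⊥ := Nat.find_min hex (by omega)
    rw [hk, derivedSeries_succ, Subgroup.commutator_eq_bot_iff_le_centralizer] at h1
    refine ⟨(derivedSeries N k).map N.subtype, inferInstance, Subgroup.map_subtype_le _, ?_, ?_⟩
    · rwa [Ne, Subgroup.map_eq_bot_iff_of_injective _ N.subtype_injective]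
    · rintro _ ⟨x, hx, rfl⟩ _ ⟨y, hy, rfl⟩
      have := Subgroup.mem_centralizer_iff.1 (h1 hx) y hy
      exact congrArg N.subtype this.symm
  have hcard : Nat.card D ≠ 1 := fun h => hD (Subgroup.card_eq_one.1 h)
  obtain ⟨p, hp, hpd⟩ := Nat.exists_prime_and_dvd hcard
  have := Fact.mk hp
  obtain ⟨x, hx⟩ := exists_prime_orderOf_dvd_card' (G := D) p hpd
  refine ⟨p, hp,
    { carrier := {x | x ∈ D ∧ x ^ p = 1}
      one_mem' := ⟨D.one_mem, one_pow p⟩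
      mul_mem' := fun {a b} ha hb => ⟨D.mul_mem ha.1 hb.1, by
        rw [(show Commute a b from hcomm a ha.1 b hb.1).mul_pow, ha.2, hb.2, one_mul]⟩
      inv_mem' := fun {a} ha => ⟨D.inv_mem ha.1, by rw [inv_pow, ha.2, inv_one]⟩ },
    ⟨fun a ha g => ⟨hDn.conj_mem a ha.1 g, by rw [conj_pow, ha.2]; simp⟩⟩, ?_,
    fun a ha => hDN ha.1, fun a ha => ha.2⟩
  intro h
  have hmem : (x : G) ∈ (⊥ : Subgroup G) := by
    rw [← h]
    exact ⟨x.2, by exact_mod_cast congrArg Subtype.val (hx ▸ pow_orderOf_eq_one x)⟩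
  have hx1 : x = 1 := Subtype.ext (Subgroup.mem_bot.1 hmem)
  rw [hx1, orderOf_one] at hx
  exact hp.one_lt.ne hx

theorem exists_normal_lt_pow_mem {G : Type*} [Group G] [Finite G] {F N : Subgroup G} [F.Normal]
    [N.Normal] [Group.IsSolvable N] (hFN : F < N) :
    ∃ p : ℕ, p.Prime ∧ ∃ M : Subgroup G, M.Normal ∧ F < M ∧ M ≤ N ∧ ∀ x ∈ M, x ^ p ∈ F := by
  have : (N.map (QuotientGroup.mk' F)).Normal :=
    Subgroup.Normal.map inferInstance _ (QuotientGroup.mk'_surjective F)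
  have : Group.IsSolvable (N.map (QuotientGroup.mk' F)) :=
    Group.isSolvable_of_surjective ((QuotientGroup.mk' F).subgroupMap_surjective N)
  have hne : N.map (QuotientGroup.mk' F) ≠ ⊥ := by
    rw [Ne, Subgroup.map_eq_bot_iff, QuotientGroup.ker_mk']
    exact hFN.not_ge
  obtain ⟨p, hp, B, hB, hB1, hBN, hpow⟩ := exists_normal_ne_bot_pow_eq_one _ hne
  have hFM : F ≤ B.comap (QuotientGroup.mk' F) := by
    conv_lhs => rw [← QuotientGroup.ker_mk' F]
    exact Subgroup.ker_le_comap _ _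
  refine ⟨p, hp, B.comap (QuotientGroup.mk' F), inferInstance, lt_of_le_not_ge hFM ?_, ?_, ?_⟩
  · intro h
    apply hB1
    rw [eq_bot_iff, ← Subgroup.map_comap_eq_self_of_surjective (QuotientGroup.mk'_surjective F) B,
      Subgroup.map_le_iff_le_comap, MonoidHom.comap_bot, QuotientGroup.ker_mk']
    exact h
  · refine (Subgroup.comap_mono hBN).trans ?_
    rw [Subgroup.comap_map_eq, QuotientGroup.ker_mk']
    exact sup_le le_rfl hFN.le
  · intro x hx
    rw [← QuotientGroup.eq_one_iff]
    exact hpow _ hx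

theorem exists_supplement {G : Type} [Group G] [Finite G] {N : Subgroup G} [N.Normal]
    [Group.IsSolvable N] {F : Subgroup G} [F.Normal] (hFN : F < N)
    (hF : ∀ K : Subgroup G, K.Normal → Group.IsNilpotent K → K ≤ N → K ≤ F) :
    ∃ M H : Subgroup G, M.Normal ∧ F < M ∧ F ⊔ H = ⊤ ∧ M ⊓ H.normalCore ≤ F := by
  obtain ⟨p, hp, M, hM, hFM, hMN, hpow⟩ := exists_normal_lt_pow_mem hFN
  have := Fact.mk hp
  obtain ⟨Q⟩ : Nonempty (Sylow p M) := inferInstance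
  set P : Subgroup G := (Q : Subgroup M).map M.subtype with hP
  have hPM : P ≤ M := Subgroup.map_subtype_le _
  have hmemP : ∀ y ∈ M, y ∈ Subgroup.normalizer (P : Set G) → (∃ k, y ^ p ^ k = 1) → y ∈ P := by
    rintro y hyM hyN ⟨k, hk⟩
    have hpg : IsPGroup p (Subgroup.zpowers (⟨y, hyM⟩ : M)) := by
      rintro ⟨z, hz⟩
      obtain ⟨j, rfl⟩ := Subgroup.mem_zpowers_iff.1 hz
      refine ⟨k, Subtype.ext ?_⟩
      have : (⟨y, hyM⟩ : M) ^ p ^ k = 1 := Subtype.ext (by simpa using hk)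
      change ((⟨y, hyM⟩ : M) ^ j) ^ p ^ k = 1
      rw [← zpow_natCast, ← zpow_mul, mul_comm, zpow_mul, zpow_natCast, this, one_zpow]
    have hn : (⟨y, hyM⟩ : M) ∈ Subgroup.normalizer ((Q : Subgroup M) : Set M) := by
      rw [Subgroup.mem_normalizer_iff] at hyN ⊢
      intro h
      have := hyN h
      simpa [hP, Subgroup.mem_map, hM.conj_mem _ h.2 y] using! this
    have h := hpg.inf_normalizer_sylow Q
    have : (⟨y, hyM⟩ : M) ∈ Subgroup.zpowers (⟨y, hyM⟩ : M) ⊓ Q := by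
      rw [← h]; exact ⟨Subgroup.mem_zpowers _, hn⟩
    exact ⟨_, this.2, rfl⟩
  have hPpow : ∀ y ∈ P, ∃ k, y ^ p ^ k = 1 := by
    rintro _ ⟨y, hy, rfl⟩
    obtain ⟨k, hk⟩ := Q.isPGroup' ⟨y, hy⟩
    exact ⟨k, by simpa [Subtype.ext_iff] using hk⟩
  refine ⟨M, Subgroup.normalizer (P : Set G), hM, hFM, ?_, ?_⟩
  · have h1 : Subgroup.normalizer (P : Set G) ⊔ M = ⊤ := Sylow.normalizer_sup_eq_top Q
    have h2 : M ≤ F ⊔ P := by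
      have : (F.subgroupOf M).Normal := inferInstance
      have hidx : F.subgroupOf M ⊔ Q = ⊤ := by
        rw [← Subgroup.index_eq_one]
        have ha : (F.subgroupOf M ⊔ Q).index ∣ (F.subgroupOf M).index :=
          Subgroup.index_dvd_of_le le_sup_left
        have hb : (F.subgroupOf M ⊔ Q).index ∣ (Q : Subgroup M).index :=
          Subgroup.index_dvd_of_le le_sup_right
        have hpq : IsPGroup p (M ⧸ F.subgroupOf M) := by
          intro x
          obtain ⟨x, rfl⟩ := QuotientGroup.mk_surjective x
          refine ⟨1, ?_⟩
          rw [pow_one, ← QuotientGroup.mk_pow, QuotientGroup.eq_one_iff, Subgroup.mem_subgroupOf]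
          exact hpow x x.2
        obtain ⟨n, hn⟩ := IsPGroup.iff_card.1 hpq
        rw [← Subgroup.index_eq_card] at hn
        rw [hn] at ha
        have hcop : Nat.Coprime (p ^ n) (Q : Subgroup M).index :=
          Nat.Coprime.pow_left _ ((Nat.Prime.coprime_iff_not_dvd hp).2 Q.not_dvd_index)
        exact Nat.eq_one_of_dvd_coprimes hcop ha hb
      have := congrArg (Subgroup.map M.subtype) hidx
      rw [Subgroup.map_sup, Subgroup.subgroupOf_map_subtype, inf_eq_left.2 hFM.le,
        ← MonoidHom.range_eq_map, Subgroup.range_subtype] at this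
      exact this.ge
    rw [eq_top_iff, ← h1]
    exact sup_le le_sup_right (h2.trans (sup_le_sup_left Subgroup.le_normalizer _))
  · set X := M ⊓ (Subgroup.normalizer (P : Set G)).normalCore with hX
    have hXn : X.Normal := inferInstance
    have hXN : X ≤ Subgroup.normalizer (P : Set G) :=
      inf_le_right.trans (Subgroup.normalCore_le _)
    have hYF : X ⊓ P ≤ F := by
      refine hF _ ⟨?_⟩ ?_ (inf_le_right.trans (hPM.trans hMN))
      · rintro y ⟨hyX, hyP⟩ g
        have hc := hXn.conj_mem y hyX g
        obtain ⟨k, hk⟩ := hPpow y hyP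
        exact ⟨hc, hmemP _ hc.1 (hXN hc) ⟨k, by rw [conj_pow, hk]; simp⟩⟩
      · have : IsPGroup p (X ⊓ P : Subgroup G) := by
          rintro ⟨y, hy⟩
          obtain ⟨k, hk⟩ := hPpow y hy.2
          exact ⟨k, Subtype.ext (by simpa using hk)⟩
        exact this.isNilpotent
    intro x hx
    obtain ⟨a, b, hb, hab⟩ := Nat.exists_eq_pow_mul_and_not_dvd (orderOf_pos x).ne' p hp.ne_one
    have hxb : x ^ b ∈ F := by
      have hbX : x ^ b ∈ X := X.pow_mem hx b
      exact hYF ⟨hbX, hmemP _ hbX.1 (hXN hbX) ⟨a, by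
        rw [← pow_mul, mul_comm, ← hab, pow_orderOf_eq_one]⟩⟩
    have hcop : Nat.gcd p b = 1 := (Nat.Prime.coprime_iff_not_dvd hp).2 hb
    have hbez := Nat.gcd_eq_gcd_ab p b
    rw [hcop] at hbez
    have : x = (x ^ p) ^ Nat.gcdA p b * (x ^ b) ^ Nat.gcdB p b := by
      rw [← zpow_natCast, ← zpow_natCast, ← zpow_mul, ← zpow_mul, ← zpow_add, ← hbez]
      simp
    rw [this]
    exact F.mul_mem (F.zpow_mem (hpow x hx.1) _) (F.zpow_mem hxb _)

section

open Module Finset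

theorem Module.finrank_le_mul_finrank_end {k A M : Type*} [Field k] [Ring A] [Algebra k A]
    [AddCommGroup M] [Module k M] [Module A M] [IsScalarTower k A M] [IsSemisimpleModule A M]
    [FiniteDimensional k M] (m : ℕ)
    (h : ∀ S : Submodule A M, IsSimpleModule A S → finrank k S ≤ m) :
    finrank k M ≤ m * finrank k (Module.End A M) := by
  have := Module.Finite.of_restrictScalars_finite k A M
  obtain ⟨n, S, e, hS⟩ := IsSemisimpleModule.exists_linearEquiv_fin_dfinsupp A M
  have hV : finrank k M ≤ m * n := by
    let e' : M ≃ₗ[k] (Π i, S i) :=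
      (e.restrictScalars k).trans (DFinsupp.linearEquivFunOnFintype (R := k))
    have hfin : ∀ i, FiniteDimensional k (S i) := fun i =>
      FiniteDimensional.of_injective ((S i).subtype.restrictScalars k) Subtype.val_injective
    rw [e'.finrank_eq, finrank_pi_fintype]
    refine (sum_le_card_nsmul _ _ m fun i _ => h _ (hS i)).trans ?_
    simp [mul_comm]
  refine hV.trans (Nat.mul_le_mul_left m ?_)
  let φ : (Fin n → k) →ₗ[k] Module.End A M :=
    { toFun := fun c => e.symm.toLinearMap ∘ₗ
        DFinsupp.mapRange.linearMap (fun i => c i • LinearMap.id) ∘ₗ e.toLinearMap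
      map_add' := fun c d => by
        ext v
        simp only [LinearMap.coe_comp, LinearEquiv.coe_coe, Function.comp_apply,
          LinearMap.add_apply, ← map_add]
        congr 1
        ext i
        simp [add_smul]
      map_smul' := fun a c => by
        ext v
        simp only [LinearMap.coe_comp, LinearEquiv.coe_coe, Function.comp_apply,
          LinearMap.smul_apply, RingHom.id_apply]
        refine Eq.trans ?_ (LinearMap.map_smul_of_tower e.symm.toLinearMap a _)
        refine congrArg e.symm ?_
        ext i
        simp [mul_smul] }
  have hφ : Function.Injective φ := by
    intro c d hcd
    ext i
    obtain ⟨v, hv, hv0⟩ := Submodule.exists_mem_ne_zero_of_ne_bot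
      (isSimpleModule_iff_isAtom.1 (hS i)).1
    have h1 := LinearMap.congr_fun hcd (e.symm (DFinsupp.single i ⟨v, hv⟩))
    have h2 := congrArg (fun x => ((e x) i : M)) h1
    have h3 : c i • v = d i • v := by simpa [φ] using h2
    exact smul_left_injective k hv0 h3
  have : FiniteDimensional k (Module.End A M) := inferInstance
  simpa using LinearMap.finrank_le_finrank_of_injective hφ

namespace Representation

open scoped ComplexOrder in
theorem character_inv_eq_conj {G V : Type*} [Group G] [Finite G] [AddCommGroup V] [Module ℂ V]
    [FiniteDimensional ℂ V] (ρ : Representation ℂ G V) (g : G) :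
    ρ.character g⁻¹ = starRingEnd ℂ (ρ.character g) := by
  classical
  cases nonempty_fintype G
  let b := Module.finBasis ℂ V
  let A : G → Matrix (Fin (finrank ℂ V)) (Fin (finrank ℂ V)) ℂ :=
    fun g => LinearMap.toMatrix b b (ρ g)
  have hA : ∀ x y, A (x * y) = A x * A y := fun x y => by
    simp only [A, map_mul, Module.End.mul_eq_comp, LinearMap.toMatrix_comp b b b]
  have hA1 : A 1 = 1 := by simp only [A, map_one]; exact LinearMap.toMatrix_one b
  have htr : ∀ x, ρ.character x = (A x).trace := fun x => LinearMap.trace_eq_matrix_trace ℂ b _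
  let P := ∑ x, (A x).conjTranspose * A x
  have hpos : P.PosDef := by
    refine Matrix.posDef_sum univ_nonempty fun x _ => ?_
    refine Matrix.PosDef.conjTranspose_mul_self _ ?_
    refine Function.LeftInverse.injective (g := (A x⁻¹).mulVec) fun v => ?_
    rw [Matrix.mulVec_mulVec, ← hA, inv_mul_cancel, hA1, Matrix.one_mulVec]
  have hunit : IsUnit P.det := (Matrix.isUnit_iff_isUnit_det _).1 hpos.isUnit
  have hinv : (A g).conjTranspose * P * A g = P := by
    simp only [P, Finset.mul_sum, Finset.sum_mul]
    refine Fintype.sum_equiv (Equiv.mulRight g) _ _ fun x => ?_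
    simp only [Equiv.coe_mulRight, hA, Matrix.conjTranspose_mul, Matrix.mul_assoc]
  have h1 : A g⁻¹ = P⁻¹ * ((A g).conjTranspose * P) := by
    have : (A g).conjTranspose * P = P * A g⁻¹ := by
      calc (A g).conjTranspose * P = (A g).conjTranspose * P * (A g * A g⁻¹) := by
            rw [← hA, mul_inv_cancel, hA1, mul_one]
        _ = P * A g⁻¹ := by rw [← mul_assoc, hinv]
    rw [this, ← mul_assoc, Matrix.nonsing_inv_mul _ hunit, one_mul]
  rw [htr, htr, h1, Matrix.trace_mul_comm, mul_assoc, Matrix.mul_nonsing_inv _ hunit, mul_one,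
    Matrix.trace_conjTranspose]
  rfl

theorem apply_eq_one_of_character_eq {G V : Type*} [Group G] [Finite G] [AddCommGroup V]
    [Module ℂ V] [FiniteDimensional ℂ V] (ρ : Representation ℂ G V) (F : Subgroup G)
    (h : ∀ f ∈ F, ρ.character f = ρ.character 1) : ∀ f ∈ F, ρ f = 1 := by
  cases nonempty_fintype F
  have := invertibleOfNonzero (Nat.cast_ne_zero.2 Nat.card_pos.ne' : (Nat.card F : ℂ) ≠ 0)
  have hc := card_inv_mul_sum_char_eq_finrank (ρ.comp F.subtype)
  have hs : ∀ f : F, character (ρ.comp F.subtype) f = finrank ℂ V := fun f =>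
    (h f f.2).trans (char_one ρ)
  simp only [hs, sum_const, card_univ, nsmul_eq_mul, ← Nat.card_eq_fintype_card] at hc
  rw [inv_mul_cancel_left₀ (Nat.cast_ne_zero.2 Nat.card_pos.ne'), Nat.cast_inj] at hc
  have htop := Submodule.eq_top_of_finrank_eq hc.symm
  intro f hf
  ext v
  have hv : v ∈ invariants (ρ.comp F.subtype) := htop ▸ Submodule.mem_top
  exact hv ⟨f, hf⟩

theorem isIrreducible_of_isAtom {k G V : Type*} [Field k] [Group G] [AddCommGroup V] [Module k V]
    {ρ : Representation k G V} {σ : Subrepresentation ρ} (hσ : IsAtom σ) :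
    IsIrreducible σ.toRepresentation where
  exists_pair_ne := by
    refine ⟨⊥, ⊤, fun h => hσ.1 (le_bot_iff.1 fun v hv => ?_)⟩
    have : (⟨v, hv⟩ : σ.toSubmodule) ∈ (⊥ : Subrepresentation σ.toRepresentation) := by
      rw [h]; exact Submodule.mem_top
    exact congrArg Subtype.val ((Submodule.mem_bot k).1 this)
  eq_bot_or_eq_top τ := by
    let τ' : Subrepresentation ρ :=
      { toSubmodule := τ.toSubmodule.map σ.toSubmodule.subtype
        apply_mem_toSubmodule := by
          rintro g _ ⟨v, hv, rfl⟩
          exact ⟨_, τ.apply_mem_toSubmodule g hv, rfl⟩ }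
    have hle : τ' ≤ σ := by
      rintro _ ⟨v, hv, rfl⟩
      exact v.2
    rcases hσ.le_iff.1 hle with h | h
    · refine .inl (le_bot_iff.1 fun v hv => ?_)
      have hm : (v : V) ∈ τ' := ⟨v, hv, rfl⟩
      rw [h] at hm
      exact Subtype.ext ((Submodule.mem_bot k).1 hm)
    · refine .inr (top_le_iff.1 fun v _ => ?_)
      have hm : (v : V) ∈ τ' := by rw [h]; exact v.2
      obtain ⟨w, hw, hwv⟩ := hm
      exact (Subtype.ext hwv : w = v) ▸ hw

theorem finrank_le_mul_finrank_intertwiningMap {k G V : Type*} [Field k] [Group G] [Finite G]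
    [NeZero (Nat.card G : k)]
    [AddCommGroup V] [Module k V] [FiniteDimensional k V] (ρ : Representation k G V) (m : ℕ)
    (h : ∀ σ : Subrepresentation ρ, IsIrreducible σ.toRepresentation →
      finrank k σ.toSubmodule ≤ m) :
    finrank k V ≤ m * finrank k (IntertwiningMap ρ ρ) := by
  rw [← ρ.asModuleEquiv.finrank_eq, (IntertwiningMap.equivLinearMapAsModule ρ ρ).finrank_eq]
  refine finrank_le_mul_finrank_end (A := MonoidAlgebra k G) (M := ρ.asModule) m fun S hS => ?_
  exact h (Subrepresentation.ofSubmodule' S) <| isIrreducible_of_isAtom <|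
    (OrderIso.isAtom_iff Subrepresentation.subrepresentationSubmoduleOrderIso.symm _).2
      (isSimpleModule_iff_isAtom.1 hS)

end Representation

theorem MulAction.sum_card_fixedBy_mul_eq_card {G X : Type*} [Group G] [MulAction G X] [Fintype X]
    [DecidableEq X] [Nonempty X] (F : Subgroup G) [Fintype F]
    (hF : ∀ x y : X, ∃ f ∈ F, f • x = y) (g : G) :
    ∑ f : F, #{x : X | (g * f) • x = x} = Fintype.card F := by
  obtain ⟨x₀⟩ := ‹Nonempty X›
  have hcount : ∀ x y : X, #{f : F | (f : G) • x = y} = #{f : F | (f : G) • x₀ = y} := by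
    intro x y
    obtain ⟨t, ht, htx⟩ := hF x₀ x
    refine Finset.card_equiv (Equiv.mulRight ⟨t, ht⟩) fun f => ?_
    simp [mul_smul, htx]
  calc ∑ f : F, #{x : X | (g * f) • x = x}
      = ∑ x : X, #{f : F | (g * f : G) • x = x} :=
        Finset.sum_card_bipartiteAbove_eq_sum_card_bipartiteBelow
          (fun (f : F) (x : X) => (g * f : G) • x = x)
    _ = ∑ x : X, #{f : F | (f : G) • x₀ = g⁻¹ • x} := by
        refine sum_congr rfl fun x _ => ?_
        rw [← hcount x]
        simp only [mul_smul, eq_inv_smul_iff]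
    _ = ∑ y : X, #{f : F | (f : G) • x₀ = y} :=
        Fintype.sum_equiv (MulAction.toPerm g⁻¹) _ _ fun _ => rfl
    _ = Fintype.card F :=
        (card_eq_sum_card_fiberwise fun _ _ => mem_univ _).symm

namespace Representation

theorem character_ofMulAction {k G X : Type*} [Field k] [Group G] [MulAction G X] [Fintype X]
    [DecidableEq X] (g : G) : (ofMulAction k G X).character g = (#{x : X | g • x = x} : k) := by
  rw [character, LinearMap.trace_eq_matrix_trace k (MonoidAlgebra.basis X k), Matrix.trace]
  simp [LinearMap.toMatrix_apply, MonoidAlgebra.basis, Finsupp.single_apply]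

theorem finrank_irreducible_subrepresentation_tprod_le {G V X : Type} [Group G] [Finite G]
    [AddCommGroup V] [Module ℂ V] [FiniteDimensional ℂ V] (ρ : Representation ℂ G V)
    [MulAction G X] [Finite X] [Nonempty X] (F : Subgroup G)
    (hX : ∀ x y : X, ∃ f ∈ F, f • x = y) (hρ : ∀ f ∈ F, ρ f = 1)
    (hmax : ∀ (U : Type) [AddCommGroup U] [Module ℂ U] [FiniteDimensional ℂ U]
      (σ : Representation ℂ G U), IsIrreducible σ →
      (¬ ∀ f ∈ F, σ.character f = σ.character 1) → finrank ℂ U ≤ finrank ℂ V)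
    (σ : Subrepresentation (tprod ρ (ofMulAction ℂ G X)))
    (hσ : IsIrreducible σ.toRepresentation) :
    finrank ℂ σ.toSubmodule ≤ finrank ℂ V := by
  classical
  cases nonempty_fintype F
  cases nonempty_fintype X
  by_cases h : ∀ f ∈ F, σ.toRepresentation.character f = σ.toRepresentation.character 1
  · have h1 := apply_eq_one_of_character_eq _ F h
    let τ : Representation ℂ F _ := (tprod ρ (ofMulAction ℂ G X)).comp F.subtype
    have hle : σ.toSubmodule ≤ invariants τ := fun v hv f =>
      congrArg Subtype.val (LinearMap.congr_fun (h1 f f.2) ⟨v, hv⟩)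
    refine (Submodule.finrank_mono hle).trans (le_of_eq ?_)
    have hF : (Nat.card F : ℂ) ≠ 0 := Nat.cast_ne_zero.2 Nat.card_pos.ne'
    have := invertibleOfNonzero hF
    have hc := card_inv_mul_sum_char_eq_finrank τ
    have hs : ∀ f : F, τ.character f = finrank ℂ V * (#{x : X | ((1 : G) * f) • x = x} : ℂ) := by
      intro f
      have : τ.character f = (tprod ρ (ofMulAction ℂ G X)).character f := rfl
      rw [this, char_tensor, Pi.mul_apply, character_ofMulAction, character, hρ f f.2,
        LinearMap.trace_one, one_mul]
    have hcard := MulAction.sum_card_fixedBy_mul_eq_card F hX 1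
    simp only [hs, ← mul_sum] at hc
    rw [← Nat.cast_sum, hcard, ← Nat.card_eq_fintype_card, mul_comm, mul_assoc,
      mul_inv_cancel₀ hF, mul_one, Nat.cast_inj] at hc
    exact hc.symm
  · exact hmax _ _ hσ h

theorem exists_mul_mem_normalCore_of_character_ne_zero {G V : Type} [Group G] [Finite G]
    [AddCommGroup V] [Module ℂ V] [FiniteDimensional ℂ V] (ρ : Representation ℂ G V)
    (hend : finrank ℂ (IntertwiningMap ρ ρ) = 1) {F H : Subgroup G} [F.Normal] (hFH : F ⊔ H = ⊤)
    (hρ : ∀ f ∈ F, ρ f = 1)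
    (hmax : ∀ (U : Type) [AddCommGroup U] [Module ℂ U] [FiniteDimensional ℂ U]
      (σ : Representation ℂ G U), IsIrreducible σ →
      (¬ ∀ f ∈ F, σ.character f = σ.character 1) → finrank ℂ U ≤ finrank ℂ V)
    {g : G} (hg : ρ.character g ≠ 0) : ∃ f ∈ F, g * f ∈ H.normalCore := by
  classical
  cases nonempty_fintype G
  cases nonempty_fintype (G ⧸ H)
  have hGcard : (Nat.card G : ℂ) ≠ 0 := Nat.cast_ne_zero.2 Nat.card_pos.ne'
  have := invertibleOfNonzero hGcard
  have hX : ∀ x y : G ⧸ H, ∃ f ∈ F, f • x = y := by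
    have key : ∀ x : G ⧸ H, ∃ f ∈ F, f • ((1 : G) : G ⧸ H) = x := by
      intro x
      induction x using QuotientGroup.induction_on with
      | H z =>
        obtain ⟨f, hf, h, hh, rfl⟩ :=
          Subgroup.mem_sup_of_normal_left.1 (hFH ▸ Subgroup.mem_top z : z ∈ F ⊔ H)
        refine ⟨f, hf, ?_⟩
        rw [MulAction.Quotient.smul_mk, smul_eq_mul, mul_one, QuotientGroup.eq]
        simpa using hh
    intro x y
    obtain ⟨a, ha, rfl⟩ := key x
    obtain ⟨b, hb, rfl⟩ := key y
    exact ⟨b * a⁻¹, F.mul_mem hb (F.inv_mem ha), by simp [mul_smul]⟩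
  let π : G → ℕ := fun g => #{x : G ⧸ H | g • x = x}
  let w : G → ℝ := fun g => Complex.normSq (ρ.character g)
  have hπinv : ∀ g, π g⁻¹ = π g := fun g => by
    simp only [π, inv_smul_eq_iff, eq_comm (a := g • _)]
  have hπle : ∀ g, π g ≤ Fintype.card (G ⧸ H) := fun g => card_filter_le _ _
  have hw : ∀ g, (w g : ℂ) = ρ.character g * ρ.character g⁻¹ := fun g => by
    rw [character_inv_eq_conj, Complex.mul_conj]
  have hwF : ∀ g, ∀ f : F, w (g * f) = w g := fun g f => by
    simp only [w, character, map_mul, hρ f f.2, mul_one]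
  have hwsum : ∑ g, w g = Nat.card G := by
    have := card_inv_mul_sum_char_mul_char_eq_finrank ρ ρ
    rw [hend, inv_mul_eq_iff_eq_mul₀ hGcard,
      Nat.cast_one, mul_one] at this
    simp only [← hw] at this
    exact_mod_cast this
  set R := tprod ρ (ofMulAction ℂ G (G ⧸ H))
  have hd : ∑ g, w g * (π g : ℝ) ^ 2 = Nat.card G * finrank ℂ (IntertwiningMap R R) := by
    have := card_inv_mul_sum_char_mul_char_eq_finrank R R
    rw [inv_mul_eq_iff_eq_mul₀ hGcard] at this
    have h2 : ∀ g, R.character g * R.character g⁻¹ = ((w g * (π g : ℝ) ^ 2 : ℝ) : ℂ) := by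
      intro g
      have h3 : ∀ g, R.character g = ρ.character g * π g := fun g => by
        rw [char_tensor, Pi.mul_apply, character_ofMulAction]
      rw [h3, h3, hπinv]
      push_cast
      rw [hw]
      ring
    simp only [h2] at this
    exact_mod_cast this
  have hle : Fintype.card (G ⧸ H) ≤ finrank ℂ (IntertwiningMap R R) := by
    have h1 := finrank_le_mul_finrank_intertwiningMap R (finrank ℂ V)
      (finrank_irreducible_subrepresentation_tprod_le ρ F hX hρ hmax)
    have h2 : finrank ℂ (MonoidAlgebra ℂ (G ⧸ H)) = Fintype.card (G ⧸ H) :=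
      finrank_eq_card_basis (MonoidAlgebra.basis _ ℂ)
    rw [finrank_tensorProduct, h2] at h1
    have : Nontrivial V := by
      by_contra hV
      have := not_nontrivial_iff_subsingleton.1 hV
      exact hg (by simp [character, Subsingleton.elim (ρ g) 0])
    exact Nat.le_of_mul_le_mul_left h1 finrank_pos
  let S : G → ℝ := fun g => ∑ f : F, (π (g * f) : ℝ) ^ 2
  have hπsum : ∀ g, ∑ f : F, (π (g * f) : ℝ) = Fintype.card F := fun g => by
    exact_mod_cast MulAction.sum_card_fixedBy_mul_eq_card F hX g
  have hS : ∀ g (c : ℝ), (∀ f : F, (π (g * f) : ℝ) ≤ c) → S g ≤ c * Fintype.card F := by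
    intro g c hc
    rw [← hπsum, mul_sum]
    refine sum_le_sum fun f _ => ?_
    rw [sq]
    exact mul_le_mul_of_nonneg_right (hc f) (Nat.cast_nonneg _)
  have hSle : ∀ g, S g ≤ Fintype.card (G ⧸ H) * Fintype.card F := fun g =>
    hS g _ fun f => by exact_mod_cast hπle _
  have hwS : ∑ g, w g * S g = Fintype.card F * ∑ g, w g * (π g : ℝ) ^ 2 := by
    simp only [S, mul_sum]
    rw [sum_comm]
    simp only [← mul_sum]
    rw [← nsmul_eq_mul, ← card_univ, ← sum_const]
    refine sum_congr rfl fun f _ => ?_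
    refine Fintype.sum_equiv (Equiv.mulRight (f : G)) _ _ fun g => ?_
    simp [hwF]
  have hzero : ∑ g, w g * (Fintype.card (G ⧸ H) * Fintype.card F - S g) ≤ 0 := by
    simp only [mul_sub, sum_sub_distrib, ← sum_mul]
    rw [hwS, hd, hwsum, sub_nonpos]
    have : (Fintype.card (G ⧸ H) : ℝ) ≤ finrank ℂ (IntertwiningMap R R) := by exact_mod_cast hle
    nlinarith [mul_le_mul_of_nonneg_left this
      (by positivity : (0 : ℝ) ≤ Nat.card G * Fintype.card F)]
  have hnonneg : ∀ g ∈ univ, 0 ≤ w g * (Fintype.card (G ⧸ H) * Fintype.card F - S g) :=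
    fun g _ => mul_nonneg (Complex.normSq_nonneg _) (sub_nonneg.2 (hSle g))
  have heq := (sum_eq_zero_iff_of_nonneg hnonneg).1
    (le_antisymm hzero (sum_nonneg hnonneg)) g (mem_univ g)
  have hSg : S g = Fintype.card (G ⧸ H) * Fintype.card F :=
    (sub_eq_zero.1 ((mul_eq_zero.1 heq).resolve_left (by simpa [w] using hg))).symm
  by_contra! hcon
  have hlt : ∀ f : F, (π (g * f) : ℝ) ≤ (Fintype.card (G ⧸ H) : ℝ) - 1 := by
    intro f
    have : π (g * f) < Fintype.card (G ⧸ H) := by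
      refine lt_of_le_of_ne (hπle _) fun h => hcon f f.2 ?_
      rw [Subgroup.normalCore_eq_ker, MonoidHom.mem_ker]
      ext x
      have := (card_eq_iff_eq_univ _).1 h
      simpa [π] using this.ge (mem_univ x)
    rw [le_sub_iff_add_le]
    exact_mod_cast this
  have hpos : (0 : ℝ) < Fintype.card F := Nat.cast_pos.2 Fintype.card_pos
  linarith [hS g _ hlt]

theorem apply_eq_one_of_sum_character_ne_zero {k G V : Type*} [Field k] [Group G]
    [AddCommGroup V] [Module k V] [FiniteDimensional k V] (ρ : Representation k G V)
    (hend : finrank k (IntertwiningMap ρ ρ) = 1) {M : Subgroup G} [M.Normal] [Fintype M]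
    (hM : ∑ x : M, ρ.character x ≠ 0) : ∀ x ∈ M, ρ x = 1 := by
  let A : Module.End k V := ∑ x : M, ρ x
  have hmul : ∀ x ∈ M, ρ x * A = A := fun x hx => by
    simp only [A, mul_sum, ← map_mul]
    exact Fintype.sum_equiv (Equiv.mulLeft (⟨x, hx⟩ : M)) _ _ fun _ => rfl
  have hcomm : ∀ g, A * ρ g = ρ g * A := fun g => by
    simp only [A, mul_sum, sum_mul, ← map_mul]
    refine Fintype.sum_equiv (MulAut.conjNormal (H := M) g⁻¹).toEquiv _ _ fun x => ?_
    simp [← mul_assoc]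
  have hA : LinearMap.trace k V A ≠ 0 := by
    simpa only [A, map_sum, character] using hM
  let T : IntertwiningMap ρ ρ := ⟨A, hcomm⟩
  have hid : IntertwiningMap.id ρ ≠ 0 := fun h => hA <| by
    have : A = 0 := LinearMap.ext fun v => by
      rw [← show IntertwiningMap.id ρ (A v) = A v from rfl, h]
      rfl
    rw [this, map_zero]
  obtain ⟨c, hc⟩ := (finrank_eq_one_iff_of_nonzero' _ hid).1 hend T
  have hAc : ∀ v, A v = c • v := fun v => (DFunLike.congr_fun hc v).symm
  have hc0 : c ≠ 0 := by
    rintro rfl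
    exact hA (by rw [show A = 0 from LinearMap.ext fun v => by simp [hAc], map_zero])
  intro x hx
  ext v
  have := LinearMap.congr_fun (hmul x hx) v
  rw [Module.End.mul_apply, hAc, map_smul] at this
  exact smul_right_injective V hc0 this

theorem false_of_forall_finrank_le {G V : Type} [Group G] [Finite G]
    [AddCommGroup V] [Module ℂ V] [FiniteDimensional ℂ V] (ρ : Representation ℂ G V)
    (hend : finrank ℂ (IntertwiningMap ρ ρ) = 1) {F H M : Subgroup G} [F.Normal] [M.Normal]
    (hFM : F < M) (hFH : F ⊔ H = ⊤) (hMH : M ⊓ H.normalCore ≤ F) (hρ : ∀ f ∈ F, ρ f = 1)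
    (hmax : ∀ (U : Type) [AddCommGroup U] [Module ℂ U] [FiniteDimensional ℂ U]
      (σ : Representation ℂ G U), IsIrreducible σ →
      (¬ ∀ f ∈ F, σ.character f = σ.character 1) → finrank ℂ U ≤ finrank ℂ V) : False := by
  classical
  cases nonempty_fintype M
  have hV : Nontrivial V := by
    by_contra hV
    have := not_nontrivial_iff_subsingleton.1 hV
    have : Subsingleton (IntertwiningMap ρ ρ) :=
      ⟨fun _ _ => DFunLike.ext _ _ fun _ => Subsingleton.elim _ _⟩
    rw [finrank_zero_of_subsingleton] at hend
    exact zero_ne_one hend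
  have hV0 : (finrank ℂ V : ℂ) ≠ 0 := Nat.cast_ne_zero.2 finrank_pos.ne'
  have hF : ∀ x : G, ρ x = 1 → ρ.character x = finrank ℂ V := fun x hx => by
    rw [character, hx, LinearMap.trace_one]
  have hvanish : ∀ x ∈ M, x ∉ F → ρ.character x = 0 := fun x hx hxF => by
    by_contra h
    obtain ⟨f, hf, hxf⟩ := exists_mul_mem_normalCore_of_character_ne_zero ρ hend hFH hρ hmax h
    exact hxF ((F.mul_mem_cancel_right hf).1 (hMH ⟨M.mul_mem hx (hFM.le hf), hxf⟩))
  have hsum : ∑ x : M, ρ.character x ≠ 0 := by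
    have : ∀ x : M, ρ.character x = if (x : G) ∈ F then (finrank ℂ V : ℂ) else 0 := fun x => by
      split_ifs with h
      · exact hF x (hρ x h)
      · exact hvanish x x.2 h
    simp only [this, sum_ite, sum_const_zero, add_zero, sum_const, nsmul_eq_mul]
    refine mul_ne_zero (Nat.cast_ne_zero.2 (card_pos.2 ⟨1, ?_⟩).ne') hV0
    simp [F.one_mem]
  obtain ⟨x, hx, hxF⟩ := SetLike.exists_of_lt hFM
  exact hV0 ((hF x (apply_eq_one_of_sum_character_ne_zero ρ hend hsum x hx)).symm.trans
    (hvanish x hx hxF))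

end Representation

end

/-- **Corollary 4.3.** Let `N ⊴ G` be nontrivial and solvable, let `F = Fit(N)`
(viewed as a subgroup of `G`), and let `m = max cd(G|N)`.  Then
`m ∉ cd(G/F | N/F)`, and consequently `cd(G/F | N/F)` is a proper subset of `cd(G|N)`. -/
theorem stmt6 (G : Type) [Group G] [Fintype G] (N : Subgroup G) [N.Normal]
    (hN : N ≠ ⊥) (hsol : IsSolvable ↥N)
    (m : ℕ) (hm : IsGreatest (cdOver G N) m) :
    m ∉ cdOverRel G N ((fittingSubgroup ↥N).map N.subtype) ∧
      cdOverRel G N ((fittingSubgroup ↥N).map N.subtype) ⊂ cdOver G N := by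
  classical
  set F := (fittingSubgroup N).map N.subtype
  have hFN : F ≤ N := Subgroup.map_subtype_le _
  have hnot : m ∉ cdOverRel G N F := by
    rintro ⟨V, hV, hVF, hVN, rfl⟩
    have : Group.IsSolvable N := hsol
    have : F.Normal := ConjAct.normal_of_characteristic_of_normal
    have hlt : F < N := lt_of_le_of_ne hFN fun h => hVN fun n hn => hVF n (h ▸ hn)
    obtain ⟨M, H, hM, hFM, hFH, hMH⟩ := exists_supplement hlt
      fun K _ _ hKN => le_map_fittingSubgroup hKN
    have hcard : (Nat.card G : ℂ) ≠ 0 := Nat.cast_ne_zero.2 Nat.card_pos.ne'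
    have := invertibleOfNonzero hcard
    have hend : Module.finrank ℂ (Representation.IntertwiningMap V.ρ V.ρ) = 1 := by
      have h1 := Representation.card_inv_mul_sum_char_mul_char_eq_finrank V.ρ V.ρ
      have h2 : ∑ g : G, Representation.character V.ρ g *
          Representation.character V.ρ g⁻¹ = Nat.card G :=
        (FDRep.simple_iff_char_is_norm_one V).1 hV
      rw [h2, inv_mul_cancel₀ hcard] at h1
      exact_mod_cast h1.symm
    refine Representation.false_of_forall_finrank_le V.ρ hend hFM hFH hMH
      (Representation.apply_eq_one_of_character_eq V.ρ F hVF) fun U _ _ _ σ hσ hU => ?_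
    refine hm.2 ⟨FDRep.of σ, (FDRep.simple_iff_char_is_norm_one _).2 ?_,
      fun h => hU fun f hf => h f (hFN hf), rfl⟩
    have h1 := Representation.card_inv_mul_sum_char_mul_char_eq_finrank σ σ
    rw [Representation.IsIrreducible.finrank_intertwiningMap_self, Nat.cast_one,
      inv_mul_eq_iff_eq_mul₀ hcard, mul_one] at h1
    exact h1
  refine ⟨hnot, fun d ⟨V, hV, _, hVN, hd⟩ => ⟨V, hV, hVN, hd⟩, fun h => hnot (h hm.1)⟩
end

section
/- Let G be a finite group, N a nontrivial normal subgroup of G, M a normal subgroup of G with M ⊆ N, and m = max(cd(G|N)). Suppose the Fitting subgroup Fit(M) is a p-group for a prime p. If m ∈ cd(G/M' | N/M'), then M is a p-group. -/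
open CategoryTheory

namespace Representation

variable {G V W : Type} [Group G] [AddCommGroup V] [Module ℂ V] [AddCommGroup W] [Module ℂ W]

theorem isIrreducible_of_forall [Nontrivial V] (ρ : Representation ℂ G V)
    (h : ∀ U : Submodule ℂ V, (∀ g, ∀ v ∈ U, ρ g v ∈ U) → U = ⊥ ∨ U = ⊤) : IsIrreducible ρ where
  exists_pair_ne := ⟨⊥, ⊤, fun e ↦ bot_ne_top (congrArg Subrepresentation.toSubmodule e)⟩
  eq_bot_or_eq_top U := (h U.toSubmodule fun g _ hv ↦ U.apply_mem_toSubmodule g hv).imp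
    (fun e ↦ Subrepresentation.toSubmodule_injective e)
    (fun e ↦ Subrepresentation.toSubmodule_injective e)

theorem IsIrreducible.eq_bot_or_eq_top_of_invariant {ρ : Representation ℂ G V} (hρ : IsIrreducible ρ)
    (U : Submodule ℂ V) (hU : ∀ g, ∀ v ∈ U, ρ g v ∈ U) : U = ⊥ ∨ U = ⊤ :=
  (hρ.eq_bot_or_eq_top ⟨U, hU⟩).imp (congrArg Subrepresentation.toSubmodule)
    (congrArg Subrepresentation.toSubmodule)

theorem IsIrreducible.nontrivial {ρ : Representation ℂ G V} (hρ : IsIrreducible ρ) :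
    Nontrivial V := by
  by_contra h
  rw [not_nontrivial_iff_subsingleton] at h
  obtain ⟨a, b, hab⟩ := hρ.exists_pair_ne
  exact hab (Subrepresentation.toSubmodule_injective (Subsingleton.elim _ _))

/-- The sum of a character over a subgroup counts the invariants of the subgroup. -/
theorem finsum_character_subgroup [Finite G] [FiniteDimensional ℂ V]
    (ρ : Representation ℂ G V) (N : Subgroup G) :
    ∑ᶠ n : N, ρ.character n =
      (Nat.card N : ℂ) * Module.finrank ℂ (invariants (ρ.comp N.subtype)) := by
  have := Fintype.ofFinite N
  have hc : (Nat.card N : ℂ) ≠ 0 := Nat.cast_ne_zero.2 Nat.card_pos.ne'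
  have := invertibleOfNonzero hc
  rw [← card_inv_mul_sum_char_eq_finrank, mul_inv_cancel_left₀ hc, finsum_eq_sum_of_fintype]
  rfl

/-- A subgroup on which the character is constant acts trivially. -/
theorem apply_eq_one_of_character_eq_s9 [Finite G] [FiniteDimensional ℂ V]
    (ρ : Representation ℂ G V) (N : Subgroup G) (h : ∀ n ∈ N, ρ.character n = ρ.character 1)
    (n : G) (hn : n ∈ N) : ρ n = 1 := by
  have := Fintype.ofFinite N
  have hc : (Nat.card N : ℂ) ≠ 0 := Nat.cast_ne_zero.2 Nat.card_pos.ne'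
  have key := finsum_character_subgroup ρ N
  rw [finsum_congr fun n : N ↦ h n n.2, finsum_eq_sum_of_fintype, Finset.sum_const, char_one,
    Finset.card_univ, Fintype.card_eq_nat_card, nsmul_eq_mul, mul_right_inj' hc, Nat.cast_inj] at key
  have htop := Submodule.eq_top_of_finrank_eq key.symm
  ext v
  exact (htop ▸ Submodule.mem_top : v ∈ invariants (ρ.comp N.subtype)) ⟨n, hn⟩

theorem simple_of [Finite G] [FiniteDimensional ℂ V] (ρ : Representation ℂ G V)
    [IsIrreducible ρ] : Simple (FDRep.of ρ) := by
  classical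
  have := Fintype.ofFinite G
  have hc : (Nat.card G : ℂ) ≠ 0 := Nat.cast_ne_zero.2 Nat.card_pos.ne'
  have := invertibleOfNonzero hc
  rw [FDRep.simple_iff_char_is_norm_one]
  have := char_orthonormal ρ ρ
  rw [if_pos ⟨Equiv.refl ρ⟩, inv_mul_eq_iff_eq_mul₀ hc, mul_one] at this
  exact this

theorem isIrreducible_of_simple (V : FDRep ℂ G) [Simple V] : IsIrreducible V.ρ := by
  have hV : Nontrivial V := by
    by_contra h
    rw [not_nontrivial_iff_subsingleton] at h
    refine id_nonzero V ?_
    ext v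
    exact Subsingleton.elim _ _
  refine isIrreducible_of_forall _ fun U hU ↦ ?_
  let σ : Representation ℂ G U := (Subrepresentation.mk U hU).toRepresentation
  let f : FDRep.of σ ⟶ V :=
    ⟨FGModuleCat.ofHom U.subtype, fun g ↦ by ext v; rfl⟩
  have hf : Mono f := by
    apply ConcreteCategory.mono_of_injective
    exact Subtype.val_injective
  by_cases h0 : f = 0
  · left
    rw [eq_bot_iff]
    intro v hv
    have : f.hom ⟨v, hv⟩ = (0 : FDRep.of σ ⟶ V).hom ⟨v, hv⟩ := by rw [h0]
    exact this
  · right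
    have := isIso_of_mono_of_nonzero h0
    exact Submodule.eq_top_of_finrank_eq (FDRep.isoToLinearEquiv (asIso f)).finrank_eq


theorem character_eq_add_of_isCompl [FiniteDimensional ℂ V] (ρ : Representation ℂ G V)
    (U U' : Subrepresentation ρ) (h : IsCompl U.toSubmodule U'.toSubmodule) (g : G) :
    ρ.character g = U.toRepresentation.character g + U'.toRepresentation.character g := by
  rw [character, character, character, ← LinearMap.trace_prodMap',
    ← LinearMap.trace_conj' _ (Submodule.prodEquivOfIsCompl _ _ h)]
  congr 1
  ext v
  obtain ⟨⟨u, u'⟩, rfl⟩ := (Submodule.prodEquivOfIsCompl _ _ h).surjective v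
  rw [LinearEquiv.conj_apply_apply, LinearEquiv.symm_apply_apply]
  simp [Submodule.coe_prodEquivOfIsCompl', Subrepresentation.toRepresentation]

/-- A linear relation between a character value and the degree that holds for all irreducible
subrepresentations holds for the whole representation. -/
theorem mul_character_eq_of_irreducible [Finite G] [FiniteDimensional ℂ W]
    (τ : Representation ℂ G W) (x : G) (a c : ℂ)
    (h : ∀ (S : Type) [AddCommGroup S] [Module ℂ S] [FiniteDimensional ℂ S]
      (σ : Representation ℂ G S) (f : S →ₗ[ℂ] W), IsIrreducible σ → Function.Injective f →
      (∀ g v, f (σ g v) = τ g (f v)) → a * σ.character x = Module.finrank ℂ S * c) :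
    a * τ.character x = Module.finrank ℂ W * c := by
  induction hd : Module.finrank ℂ W using Nat.strong_induction_on generalizing W with
  | _ d ih =>
  subst hd
  by_cases hτ : IsIrreducible τ
  · exact h W τ .id hτ Function.injective_id fun _ _ ↦ rfl
  by_cases hW : Nontrivial W
  · have : ¬ ∀ U : Submodule ℂ W, (∀ g, ∀ v ∈ U, τ g v ∈ U) → U = ⊥ ∨ U = ⊤ :=
      fun h ↦ hτ (isIrreducible_of_forall τ h)
    push Not at this
    obtain ⟨U, hU, hbot, htop⟩ := this
    have hc : NeZero (Nat.card G : ℂ) := ⟨Nat.cast_ne_zero.2 Nat.card_pos.ne'⟩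
    obtain ⟨T, hT⟩ := exists_isCompl (Subrepresentation.mk U hU)
    have hT' : IsCompl U T.toSubmodule := by
      constructor
      · rw [disjoint_iff]
        exact congrArg Subrepresentation.toSubmodule hT.inf_eq_bot
      · rw [codisjoint_iff]
        exact congrArg Subrepresentation.toSubmodule hT.sup_eq_top
    have hsum := Submodule.finrank_add_eq_of_isCompl hT'
    have hpos : 0 < Module.finrank ℂ U := by
      rw [Module.finrank_pos_iff]
      exact Submodule.nontrivial_iff_ne_bot.2 hbot
    have hlt : Module.finrank ℂ U < Module.finrank ℂ W := Submodule.finrank_lt htop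
    have h1 := ih _ hlt (Subrepresentation.mk U hU).toRepresentation
      (fun S _ _ _ σ f hσ hf hg ↦ h S σ (U.subtype ∘ₗ f) hσ
        (Subtype.val_injective.comp hf) fun g v ↦ congrArg Subtype.val (hg g v)) rfl
    have h2 := ih _ (by omega) T.toRepresentation
      (fun S _ _ _ σ f hσ hf hg ↦ h S σ (T.toSubmodule.subtype ∘ₗ f) hσ
        (Subtype.val_injective.comp hf) fun g v ↦ congrArg Subtype.val (hg g v)) rfl
    rw [character_eq_add_of_isCompl τ (Subrepresentation.mk U hU) T hT', mul_add, h1, h2, ← hsum]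
    push_cast
    ring
  · rw [not_nontrivial_iff_subsingleton] at hW
    have : τ x = 0 := Subsingleton.elim _ _
    simp [character, this, Module.finrank_zero_of_subsingleton]

/-- The representation `V ⊗ ℂ[X]` of `G`, realised on functions from the `G`-set `X` to `V`. -/
def functions (X : Type) [MulAction G X] (ρ : Representation ℂ G V) :
    Representation ℂ G (X → V) where
  toFun g :=
    { toFun := fun f y ↦ ρ g (f (g⁻¹ • y))
      map_add' := fun _ _ ↦ by ext; simp
      map_smul' := fun _ _ ↦ by ext; simp }
  map_one' := by ext; simp
  map_mul' g h := by ext; simp [mul_smul]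

@[simp]
theorem functions_apply (X : Type) [MulAction G X] (ρ : Representation ℂ G V) (g : G)
    (f : X → V) (y : X) : functions X ρ g f y = ρ g (f (g⁻¹ • y)) := rfl

theorem character_functions (X : Type) [MulAction G X] [Fintype X] [FiniteDimensional ℂ V]
    (ρ : Representation ℂ G V) (x : G) [DecidablePred fun y : X ↦ x⁻¹ • y = y] :
    (functions X ρ).character x =
      (Finset.univ.filter fun y : X ↦ x⁻¹ • y = y).card * ρ.character x := by
  classical
  let b := Module.finBasis ℂ V
  rw [character, character, LinearMap.trace_eq_matrix_trace ℂ (Pi.basis fun _ : X ↦ b),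
    LinearMap.trace_eq_matrix_trace ℂ b, Matrix.trace, Matrix.trace, Fintype.sum_sigma,
    Finset.card_eq_sum_ones, Nat.cast_sum, Finset.sum_mul, Finset.sum_filter]
  refine Finset.sum_congr rfl fun y _ ↦ ?_
  simp only [Matrix.diag_apply, LinearMap.toMatrix_apply, Pi.basis_repr, Pi.basis_apply,
    functions_apply]
  split_ifs with h
  · simp [h]
  · simp [Pi.single_eq_of_ne h]

/-- Let `χ` be an irreducible character of `G` whose kernel contains `K` but not `N ≥ K`, and
which has maximal degree among the irreducible characters whose kernel does not contain `N`.
If `G = H K`, then `χ` vanishes on the elements of `H` outside the core of `H`. -/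
theorem conj_mem_of_character_ne_zero [Finite G] [FiniteDimensional ℂ V]
    (ρ : Representation ℂ G V) (hρ : IsIrreducible ρ) (K N H : Subgroup G) (hKN : K ≤ N)
    (hHK : H ⊔ K = ⊤) [K.Normal]
    (hK : ∀ k ∈ K, ρ k = 1) (hN : ¬ ∀ n ∈ N, ρ n = 1)
    (hmax : ∀ (S : Type) [AddCommGroup S] [Module ℂ S] [FiniteDimensional ℂ S]
      (σ : Representation ℂ G S), IsIrreducible σ → (¬ ∀ n ∈ N, σ n = 1) →
      Module.finrank ℂ S ≤ Module.finrank ℂ V)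
    {x : G} (hx : x ∈ H) (hχ : ρ.character x ≠ 0) (g : G) : g⁻¹ * x * g ∈ H := by
  classical
  have hdec (g : G) : ∃ h ∈ H, ρ g = ρ h ∧ h⁻¹ * g ∈ K := by
    obtain ⟨h, hh, k, hk, rfl⟩ := Subgroup.mem_sup_of_normal_right.1 (hHK ▸ Subgroup.mem_top g)
    exact ⟨h, hh, by rw [map_mul, hK k hk, mul_one], by simpa using hk⟩
  have := Fintype.ofFinite (G ⧸ H)
  have hVpos : (Module.finrank ℂ V : ℂ) ≠ 0 := by
    have := hρ.nontrivial
    exact Nat.cast_ne_zero.2 Module.finrank_pos.ne'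
  have key := mul_character_eq_of_irreducible (functions (G ⧸ H) ρ) x (Module.finrank ℂ V)
    (ρ.character x) fun S _ _ _ σ f hσ hf hfg ↦ by
      let e : S →ₗ[ℂ] V := LinearMap.proj ((1 : G) : G ⧸ H) ∘ₗ f
      have he (h : G) (hh : h ∈ H) (v : S) : e (σ h v) = ρ h (e v) := by
        have h1 : (h⁻¹ • ((1 : G) : G ⧸ H)) = ((1 : G) : G ⧸ H) := by
          rw [MulAction.Quotient.smul_coe, QuotientGroup.eq]
          simpa using hh
        simp only [e, LinearMap.comp_apply, hfg, LinearMap.proj_apply, functions_apply, h1]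
      have hne : LinearMap.range e ≠ ⊥ := by
        intro h0
        rw [LinearMap.range_eq_bot] at h0
        have := hσ.nontrivial
        obtain ⟨v, hv⟩ := exists_ne (0 : S)
        refine hv (hf ?_)
        rw [map_zero]
        ext y
        obtain ⟨g, rfl⟩ := QuotientGroup.mk_surjective y
        have h2 : e (σ g⁻¹ v) = 0 := by rw [h0]; rfl
        simp only [e, LinearMap.comp_apply, hfg, LinearMap.proj_apply, functions_apply, inv_inv,
          MulAction.Quotient.smul_coe, smul_eq_mul, mul_one] at h2
        have h3 := congrArg (ρ g) h2
        rwa [← Module.End.mul_apply, ← map_mul, mul_inv_cancel, map_one, map_zero] at h3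
      have hsurj : LinearMap.range e = ⊤ := by
        refine (hρ.eq_bot_or_eq_top_of_invariant _ ?_).resolve_left hne
        rintro g _ ⟨v, rfl⟩
        obtain ⟨h, hh, hgh, -⟩ := hdec g
        exact ⟨σ h v, by rw [he h hh, hgh]⟩
      rw [LinearMap.range_eq_top] at hsurj
      have hSN : ¬ ∀ n ∈ N, σ n = 1 := by
        intro hall
        refine hN fun n hn ↦ ?_
        obtain ⟨h, hh, hnh, hk⟩ := hdec n
        have hhN : h ∈ N := by
          have := N.mul_mem hn (N.inv_mem (hKN hk))
          simpa using this
        rw [hnh]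
        ext v
        obtain ⟨w, rfl⟩ := hsurj v
        rw [← he h hh, hall h hhN]
        rfl
      have hle := hmax S σ hσ hSN
      have hge := LinearMap.finrank_le_finrank_of_surjective hsurj
      have heq : Module.finrank ℂ S = Module.finrank ℂ V := le_antisymm hle hge
      let E : S ≃ₗ[ℂ] V := LinearEquiv.ofBijective e
        ⟨(LinearMap.injective_iff_surjective_of_finrank_eq_finrank heq).2 hsurj, hsurj⟩
      have hconj : E.conj (σ x) = ρ x := by
        ext v
        obtain ⟨w, rfl⟩ := E.surjective v
        rw [LinearEquiv.conj_apply_apply, E.symm_apply_apply]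
        exact he x hx w
      rw [heq]
      congr 1
      rw [character, character, ← hconj, LinearMap.trace_conj']
  rw [character_functions, Module.finrank_pi_fintype, Finset.sum_const, Finset.card_univ,
    smul_eq_mul, mul_comm (Fintype.card _), Nat.cast_mul, mul_assoc, mul_right_inj' hVpos,
    mul_left_inj' hχ, Nat.cast_inj] at key
  have hfix := Finset.mem_univ ((g : G) : G ⧸ H)
  rw [← Finset.eq_univ_of_card _ key, Finset.mem_filter] at hfix
  replace hfix := hfix.2
  rw [MulAction.Quotient.smul_coe, QuotientGroup.eq] at hfix
  simpa [mul_assoc] using hfix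

end Representation

theorem Sylow.normal_of_conj_mem_normalizer {K : Type*} [Group K] {q : ℕ} (Q : Sylow q K)
    (h : ∀ g, ∀ x ∈ Q, g * x * g⁻¹ ∈ Subgroup.normalizer (Q : Set K)) : Q.Normal where
  conj_mem x hx g := by
    have hP : IsPGroup q ((Q : Subgroup K).map (MulAut.conj g).toMonoidHom) := Q.2.map _
    have hmem : g * x * g⁻¹ ∈ (Q : Subgroup K).map (MulAut.conj g).toMonoidHom := ⟨x, hx, rfl⟩
    have h2 : g * x * g⁻¹ ∈ (Q : Subgroup K).map (MulAut.conj g).toMonoidHom ⊓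
        Subgroup.normalizer Q := ⟨hmem, h g x hx⟩
    rw [hP.inf_normalizer_sylow] at h2
    exact h2.2

open scoped commutatorElement in
theorem Group.isNilpotent_of_commutator_mem_center {K : Type*} [Group K]
    (h : ∀ x y : K, ⁅x, y⁆ ∈ Subgroup.center K) : Group.IsNilpotent K := by
  refine ⟨2, eq_top_iff.2 fun x _ ↦ ?_⟩
  rw [Subgroup.mem_upperCentralSeries_succ_iff]
  intro y
  rw [Subgroup.upperCentralSeries_one]
  exact h x y

theorem isPGroup_of_le_fittingSubgroup {H : Type} [Group H] {p : ℕ}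
    (hFit : IsPGroup p (fittingSubgroup H)) (K : Subgroup H) [hK : K.Normal]
    (hnil : Group.IsNilpotent K) : IsPGroup p K :=
  hFit.to_le (le_sSup ⟨hK, hnil⟩)

theorem IsPGroup.of_forall_sylow_eq_bot {K : Type*} [Group K] [Finite K] {p : ℕ}
    (h : ∀ q, q.Prime → q ≠ p → ∀ Q : Sylow q K, (Q : Subgroup K) = ⊥) : IsPGroup p K := by
  refine IsPGroup.of_card (Nat.eq_prime_pow_of_unique_prime_dvd Nat.card_pos.ne' ?_)
  intro q hq hdvd
  by_contra hne
  have := Fact.mk hq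
  obtain ⟨x, hx⟩ := exists_prime_orderOf_dvd_card' q hdvd
  have hpg : IsPGroup q (Subgroup.zpowers x) := IsPGroup.of_card (n := 1) (by simp [hx])
  obtain ⟨Q, hQ⟩ := hpg.exists_le_sylow
  have : x ∈ (Q : Subgroup K) := hQ (Subgroup.mem_zpowers x)
  rw [h q hq hne Q, Subgroup.mem_bot] at this
  rw [this, orderOf_one] at hx
  exact hq.one_lt.ne hx

/-- A Frattini argument for Sylow subgroups modulo the derived subgroup. -/
theorem Sylow.normalizer_sup_commutator_eq_top {G : Type*} [Group G] {M : Subgroup G} [M.Normal]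
    [Finite M] {q : ℕ} [Fact q.Prime] (Q : Sylow q M) :
    Subgroup.normalizer ((Q : Subgroup M).map M.subtype : Set G) ⊔ ⁅M, M⁆ = ⊤ := by
  have hL : (commutator M ⊔ (Q : Subgroup M)).Normal :=
    Subgroup.Normal.of_commutator_le _ le_sup_left
  have h1 := Sylow.normalizer_sup_eq_top' Q (N := commutator M ⊔ (Q : Subgroup M)) le_sup_right
  have h2 := Sylow.normalizer_sup_eq_top Q
  rw [eq_top_iff, ← h2, sup_le_iff]
  refine ⟨le_sup_left, ?_⟩
  have hQn : (Q : Subgroup M).map M.subtype ≤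
      Subgroup.normalizer ((Q : Subgroup M).map M.subtype : Set G) := Subgroup.le_normalizer
  have h3 := congrArg (Subgroup.map M.subtype) h1
  rw [Subgroup.map_sup, Subgroup.map_sup, ← MonoidHom.range_eq_map, Subgroup.range_subtype,
    Subgroup.map_subtype_commutator] at h3
  refine h3.symm.le.trans (sup_le ((Subgroup.le_normalizer_map _).trans le_sup_left)
    (sup_le le_sup_right (hQn.trans le_sup_left)))

open scoped commutatorElement in
theorem isPGroup_centralizer_commutator {G : Type} [Group G] {M : Subgroup G} [M.Normal]
    {p : ℕ} (hFit : IsPGroup p (fittingSubgroup M)) :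
    IsPGroup p ((Subgroup.centralizer ((⁅M, M⁆ : Subgroup G) : Set G)).subgroupOf M) := by
  refine isPGroup_of_le_fittingSubgroup hFit _ (Group.isNilpotent_of_commutator_mem_center ?_)
  rintro ⟨⟨x, hx⟩, hxC⟩ ⟨⟨y, hy⟩, hyC⟩
  rw [Subgroup.mem_center_iff]
  rintro ⟨⟨z, hz⟩, hzC⟩
  have := Subgroup.mem_centralizer_iff.1 (Subgroup.mem_subgroupOf.1 hzC) ⁅x, y⁆
    (Subgroup.commutator_mem_commutator hx hy)
  ext
  exact this.symm

/-- A `q`-element `x` whose conjugates normalize a `q`-subgroup `Q ∋ x` centralizes every normal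
subgroup `D` meeting `Q` trivially, provided that `D` is a `p`-group with `p ≠ q`. -/
theorem commute_of_conj_mem_normalizer {G : Type*} [Group G] {p q : ℕ} (hpq : p.Coprime q)
    {D Q : Subgroup G} [D.Normal] (hD : IsPGroup p D) (hQ : IsPGroup q Q) {x : G} (hx : x ∈ Q)
    (hconj : ∀ g, g⁻¹ * x * g ∈ Subgroup.normalizer (Q : Set G)) {k : G} (hk : k ∈ D) :
    k * x = x * k := by
  have hone {y : G} (hyD : y ∈ D) {n : ℕ} (hy : y ^ q ^ n = 1) : y = 1 := by
    obtain ⟨m, hm⟩ := hD ⟨y, hyD⟩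
    replace hm : y ^ p ^ m = 1 := congrArg Subtype.val hm
    have h := Nat.dvd_gcd (orderOf_dvd_of_pow_eq_one hm) (orderOf_dvd_of_pow_eq_one hy)
    rw [(hpq.pow m n).gcd_eq_one, Nat.dvd_one, orderOf_eq_one_iff] at h
    exact h
  have hxN : x ∈ Subgroup.normalizer (Q : Set G) := Subgroup.le_normalizer hx
  obtain ⟨c, hc⟩ : ∃ c, c = k⁻¹ * x * k * x⁻¹ := ⟨_, rfl⟩
  have hcD : c ∈ D := by
    rw [hc, mul_assoc, mul_assoc]
    have := ‹D.Normal›.conj_mem k hk x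
    exact D.mul_mem (D.inv_mem hk) (by simpa [mul_assoc] using this)
  have hcN : c ∈ Subgroup.normalizer (Q : Set G) :=
    hc ▸ Subgroup.mul_mem _ (hconj k) (Subgroup.inv_mem _ hxN)
  have hcomm : c * x * c⁻¹ * x⁻¹ = 1 := by
    have hQmem : c * x * c⁻¹ * x⁻¹ ∈ Q :=
      Q.mul_mem ((Subgroup.mem_normalizer_iff.1 hcN x).1 hx) (Q.inv_mem hx)
    have hDmem : c * x * c⁻¹ * x⁻¹ ∈ D := by
      have := ‹D.Normal›.conj_mem c⁻¹ (D.inv_mem hcD) x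
      rw [mul_assoc, mul_assoc]
      exact D.mul_mem hcD (by simpa [mul_assoc] using this)
    obtain ⟨n, hn⟩ := hQ ⟨_, hQmem⟩
    exact hone hDmem (congrArg Subtype.val hn)
  have hcx : Commute c x := by
    rw [mul_inv_eq_one, mul_inv_eq_iff_eq_mul] at hcomm
    exact hcomm
  obtain ⟨n, hn⟩ := hQ ⟨x, hx⟩
  replace hn : x ^ q ^ n = 1 := congrArg Subtype.val hn
  have hcxk : c * x = k⁻¹ * x * k := by rw [hc]; group
  have hpow : (c * x) ^ q ^ n = 1 := by
    have := conj_pow (i := q ^ n) (a := k⁻¹) (b := x)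
    rw [inv_inv] at this
    rw [hcxk, this, hn]
    group
  rw [hcx.mul_pow, hn, mul_one] at hpow
  rw [hone hcD hpow, one_mul, mul_assoc, eq_inv_mul_iff_mul_eq] at hcxk
  exact hcxk

open Representation in
/-- The statement for a single representation `ρ` of maximal degree, trivial on the derived subgroup. -/
theorem isPGroup_of_maximal_irreducible {G V : Type} [Group G] [Finite G] [AddCommGroup V]
    [Module ℂ V] [FiniteDimensional ℂ V] (ρ : Representation ℂ G V) (hρ : IsIrreducible ρ)
    {M N : Subgroup G} [M.Normal] (hMN : M ≤ N) {p : ℕ} (hp : p.Prime)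
    (hFit : IsPGroup p (fittingSubgroup M))
    (hK : ∀ k ∈ ⁅M, M⁆, ρ k = 1) (hN : ¬ ∀ n ∈ N, ρ n = 1)
    (hmax : ∀ (S : Type) [AddCommGroup S] [Module ℂ S] [FiniteDimensional ℂ S]
      (σ : Representation ℂ G S), IsIrreducible σ → (¬ ∀ n ∈ N, σ n = 1) →
      Module.finrank ℂ S ≤ Module.finrank ℂ V) : IsPGroup p M := by
  have hDM : ⁅M, M⁆ ≤ M := Subgroup.commutator_le_left M M
  have hVpos : (Module.finrank ℂ V : ℂ) ≠ 0 := by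
    have := hρ.nontrivial
    exact Nat.cast_ne_zero.2 Module.finrank_pos.ne'
  have hone {x : G} (hx : ρ x = 1) : ρ.character x ≠ 0 := by
    rwa [character, hx, LinearMap.trace_one]
  have hcore (H : Subgroup G) (hH : H ⊔ ⁅M, M⁆ = ⊤) {x : G} (hx : x ∈ H)
      (hχ : ρ.character x ≠ 0) (g : G) : g⁻¹ * x * g ∈ H :=
    conj_mem_of_character_ne_zero ρ hρ _ N H (hDM.trans hMN) hH hK hN hmax hx hχ g
  have hnil : Group.IsNilpotent (⁅M, M⁆ : Subgroup G) := by
    refine ((Group.isNilpotent_of_finite_tfae (G := (⁅M, M⁆ : Subgroup G))).out 0 3).2 ?_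
    intro q hq Q
    refine Q.normal_of_conj_mem_normalizer fun g x hx ↦ ?_
    have h := hcore _ Q.normalizer_sup_eq_top (x := x)
      (Subgroup.le_normalizer ⟨x, hx, rfl⟩) (hone (hK x x.2)) (g⁻¹ : G)
    rw [inv_inv] at h
    have hmem (z : (⁅M, M⁆ : Subgroup G)) :
        (z : G) ∈ (Q : Subgroup (⁅M, M⁆ : Subgroup G)).map (Subgroup.subtype _) ↔
          z ∈ (Q : Subgroup (⁅M, M⁆ : Subgroup G)) :=
      Subgroup.mem_map_iff_mem (Subgroup.subtype_injective _)
    exact Subgroup.mem_normalizer_iff.2 fun y ↦ (hmem y).symm.trans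
      ((Subgroup.mem_normalizer_iff.1 h y).trans (hmem (g * x * g⁻¹ * y * (g * x * g⁻¹)⁻¹)))
  have hD : IsPGroup p (⁅M, M⁆ : Subgroup G) := by
    let e := Subgroup.subgroupOfEquivOfLe hDM
    exact (isPGroup_of_le_fittingSubgroup hFit (⁅M, M⁆.subgroupOf M)
      ((Group.isNilpotent_congr e).2 hnil)).of_equiv e
  refine IsPGroup.of_forall_sylow_eq_bot fun q hq hqp Q₀ ↦ ?_
  have := Fact.mk hq
  obtain ⟨Q, hQdef⟩ : ∃ Q, Q = (Q₀ : Subgroup M).map M.subtype := ⟨_, rfl⟩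
  have hHD := Q₀.normalizer_sup_commutator_eq_top
  rw [← hQdef] at hHD
  have hQ : IsPGroup q Q := hQdef ▸ Q₀.2.map _
  have hQM : Q ≤ M := hQdef ▸ Subgroup.map_subtype_le _
  have hpq : p.Coprime q := (Nat.coprime_primes hp hq).2 hqp.symm
  have hvanish {x : G} (hx : x ∈ Q) (hχ : ρ.character x ≠ 0) : x = 1 := by
    have hcent : x ∈ Subgroup.centralizer ((⁅M, M⁆ : Subgroup G) : Set G) :=
      Subgroup.mem_centralizer_iff.2 fun k hk ↦ commute_of_conj_mem_normalizer hpq hD hQ hx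
        (hcore _ hHD (Subgroup.le_normalizer hx) hχ) hk
    obtain ⟨a, ha⟩ := isPGroup_centralizer_commutator hFit ⟨⟨x, hQM hx⟩, hcent⟩
    obtain ⟨b, hb⟩ := hQ ⟨x, hx⟩
    replace ha : x ^ p ^ a = 1 := congrArg (fun y ↦ (y.1 : G)) ha
    replace hb : x ^ q ^ b = 1 := congrArg Subtype.val hb
    have h := Nat.dvd_gcd (orderOf_dvd_of_pow_eq_one ha) (orderOf_dvd_of_pow_eq_one hb)
    rwa [(hpq.pow a b).gcd_eq_one, Nat.dvd_one, orderOf_eq_one_iff] at h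
  have hinv : invariants (ρ.comp Q.subtype) ≠ ⊥ := by
    intro h0
    have hsum := finsum_character_subgroup ρ Q
    rw [h0, finrank_bot, Nat.cast_zero, mul_zero, finsum_eq_single _ 1] at hsum
    · exact hone (map_one ρ) hsum
    · intro x hx
      by_contra hχ
      exact hx (Subtype.ext (hvanish x.2 hχ))
  have htop := (hρ.eq_bot_or_eq_top_of_invariant (invariants (ρ.comp Q.subtype)) (by
    intro g v hv x
    obtain ⟨h, hh, k, hk, rfl⟩ := Subgroup.mem_sup_of_normal_right.1 (hHD ▸ Subgroup.mem_top g)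
    rw [map_mul, hK k hk, mul_one]
    have hx := hv ⟨h⁻¹ * x * h, (Subgroup.mem_normalizer_iff''.1 hh x).1 x.2⟩
    change ρ (h⁻¹ * x * h) v = v at hx
    change ρ x (ρ h v) = ρ h v
    rw [← Module.End.mul_apply, ← map_mul]
    nth_rw 2 [← hx]
    rw [← Module.End.mul_apply, ← map_mul]
    congr 2
    group)).resolve_left hinv
  rw [eq_bot_iff]
  intro x hx
  have hxQ : (x : G) ∈ Q := hQdef ▸ ⟨x, hx, rfl⟩
  refine Subtype.ext (hvanish hxQ (hone ?_))
  ext v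
  exact (htop ▸ Submodule.mem_top : v ∈ invariants (ρ.comp Q.subtype)) ⟨x, hxQ⟩

/-- **Lemma 4.6.** Let `N ⊴ G` be nontrivial, `m = max cd(G|N)`, and `M ⊴ G` with
`M ⊆ N` such that `Fit(M)` is a `p`-group.  If `m ∈ cd(G/M' | N/M')` (where
`M' = ⁅M,M⁆`), then `M` is a `p`-group. -/
theorem stmt9 (G : Type) [Group G] [Fintype G] (N : Subgroup G) [N.Normal]
    (hN : N ≠ ⊥) (M : Subgroup G) [M.Normal] (hMN : M ≤ N)
    (p : ℕ) (hp : p.Prime)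
    (hFit : IsPGroup p ↥(fittingSubgroup ↥M))
    (m : ℕ) (hm : IsGreatest (cdOver G N) m)
    (h : m ∈ cdOver (G ⧸ ⁅M, M⁆) (N.map (QuotientGroup.mk' ⁅M, M⁆))) :
    IsPGroup p ↥M := by
  obtain ⟨U, hU, hUN, rfl⟩ := h
  have hirr := Representation.isIrreducible_of_simple U
  have := hirr.nontrivial
  let ρ : Representation ℂ G U := U.ρ.comp (QuotientGroup.mk' ⁅M, M⁆)
  refine isPGroup_of_maximal_irreducible ρ ?_ hMN hp hFit ?_ ?_ ?_
  · refine Representation.isIrreducible_of_forall ρ fun W hW ↦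
      hirr.eq_bot_or_eq_top_of_invariant W fun g v hv ↦ ?_
    obtain ⟨g, rfl⟩ := QuotientGroup.mk'_surjective _ g
    exact hW g v hv
  · intro k hk
    change U.ρ (QuotientGroup.mk' ⁅M, M⁆ k) = 1
    rw [QuotientGroup.mk'_apply, (QuotientGroup.eq_one_iff k).2 hk, map_one]
  · intro hall
    refine hUN ?_
    rintro _ ⟨n, hn, rfl⟩
    have : U.ρ (QuotientGroup.mk' ⁅M, M⁆ n) = 1 := hall n hn
    rw [FDRep.character, FDRep.character, this, map_one U.ρ]
  · intro S _ _ _ σ hσ hσN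
    exact hm.2 ⟨FDRep.of σ, Representation.simple_of σ, fun hall ↦
      hσN (Representation.apply_eq_one_of_character_eq_s9 σ N hall), rfl⟩
end

section
/- Let G be a finite group, N a nontrivial normal subgroup of G, and a = min(cd(G|N)). If H is a subgroup of G with index |G:H| ≤ a, then N ⊆ H. If moreover |G:H| < a, then N ⊆ H', the derived subgroup of H. -/
open CategoryTheory

namespace Representation

open Module

/-- An irreducible complex representation of a finite group gives a simple object of `FDRep`. -/
lemma simple_fdRep_of {G V : Type} [Group G] [Finite G] [AddCommGroup V] [Module ℂ V]
    [FiniteDimensional ℂ V] (ρ : Representation ℂ G V) [ρ.IsIrreducible] :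
    Simple (FDRep.of ρ) := by
  have := Fintype.ofFinite G
  have : NeZero (Nat.card G : ℂ) := ⟨Nat.cast_ne_zero.mpr Nat.card_pos.ne'⟩
  have := invertibleOfNonzero (NeZero.ne (Nat.card G : ℂ))
  rw [FDRep.simple_iff_char_is_norm_one]
  have h := char_orthonormal ρ ρ
  rwa [if_pos ⟨Equiv.refl ρ⟩, inv_mul_eq_one₀ (NeZero.ne _), eq_comm] at h

/-- If the character of a representation is constant on a finite group, then the representation
is trivial. -/
lemma apply_eq_self_of_character_eq {G k V : Type*} [Group G] [Finite G] [Field k] [CharZero k]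
    [AddCommGroup V] [Module k V] [FiniteDimensional k V] (ρ : Representation k G V)
    (h : ∀ g, ρ.character g = ρ.character 1) (g : G) (v : V) : ρ g v = v := by
  have := Fintype.ofFinite G
  have h0 : (Nat.card G : k) ≠ 0 := Nat.cast_ne_zero.mpr Nat.card_pos.ne'
  have := invertibleOfNonzero h0
  have h1 := card_inv_mul_sum_char_eq_finrank ρ
  simp only [h, char_one, Finset.sum_const, Finset.card_univ, nsmul_eq_mul,
    ← Nat.card_eq_fintype_card] at h1
  rw [inv_mul_cancel_left₀ h0, Nat.cast_inj] at h1
  have h2 : ρ.invariants = ⊤ := Submodule.eq_top_of_finrank_eq h1.symm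
  exact (h2 ▸ Submodule.mem_top : v ∈ ρ.invariants) g

/-- A representation of dimension smaller than all degrees in `cd(G|N)` has `N` in its kernel. -/
lemma apply_eq_self_of_finrank_lt {G V : Type} [Group G] [Finite G] {N : Subgroup G}
    {a : ℕ} (ha : a ∈ lowerBounds (cdOver G N)) [AddCommGroup V] [Module ℂ V]
    [FiniteDimensional ℂ V] (ρ : Representation ℂ G V) (hV : finrank ℂ V < a)
    {n : G} (hn : n ∈ N) (v : V) : ρ n v = v := by
  induction hd : finrank ℂ V using Nat.strong_induction_on generalizing V with
  | _ d ih =>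
  subst hd
  by_cases hρ : ρ.IsIrreducible
  · have hchar : ∀ m ∈ N, (FDRep.of ρ).character m = (FDRep.of ρ).character 1 := by
      by_contra hcon
      exact absurd (ha ⟨FDRep.of ρ, simple_fdRep_of ρ, hcon, rfl⟩) hV.not_ge
    exact apply_eq_self_of_character_eq (ρ.comp N.subtype) (fun m ↦ hchar m m.2) ⟨n, hn⟩ v
  · have : NeZero (Nat.card G : ℂ) := ⟨Nat.cast_ne_zero.mpr Nat.card_pos.ne'⟩
    rcases subsingleton_or_nontrivial V with hs | hnt
    · exact Subsingleton.elim _ _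
    have : Nontrivial (Subrepresentation ρ) :=
      ⟨⊥, ⊤, fun h ↦ bot_ne_top (congrArg Subrepresentation.toSubmodule h)⟩
    obtain ⟨σ, hσbot, hσtop⟩ : ∃ σ : Subrepresentation ρ, σ ≠ ⊥ ∧ σ ≠ ⊤ := by
      by_contra! hcon
      exact hρ ⟨fun σ ↦ or_iff_not_imp_left.mpr (hcon σ)⟩
    obtain ⟨τ, hτ⟩ := exists_isCompl σ
    have hτtop : τ ≠ ⊤ := fun h ↦ hσbot (eq_bot_of_isCompl_top (h ▸ hτ))
    have hfix (π : Subrepresentation ρ) (hπ : π ≠ ⊤) (w : V) (hw : w ∈ π.toSubmodule) :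
        ρ n w = w := by
      have hlt : finrank ℂ π.toSubmodule < finrank ℂ V :=
        Submodule.finrank_lt fun h ↦ hπ (Subrepresentation.toSubmodule_injective h)
      exact congrArg Subtype.val
        (ih _ hlt π.toRepresentation (hlt.trans hV) ⟨w, hw⟩ rfl)
    have hv : v ∈ σ.toSubmodule ⊔ τ.toSubmodule := by
      rw [← Subrepresentation.toSubmodule_sup, hτ.sup_eq_top]
      exact Submodule.mem_top
    obtain ⟨s, hs, t, ht, rfl⟩ := Submodule.mem_sup.mp hv
    rw [map_add, hfix σ hσtop s hs, hfix τ hτtop t ht]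

/-- The dimension of a representation coinduced from a subgroup is at most the index times the
dimension of the original representation. -/
lemma finrank_coindV_le {G k A : Type*} [Group G] [Finite G] [Field k] [AddCommGroup A]
    [Module k A] [FiniteDimensional k A] (H : Subgroup G) (σ : Representation k H A) :
    finrank k (coindV H.subtype σ) ≤ H.index * finrank k A := by
  have := Fintype.ofFinite (G ⧸ H)
  let r : coindV H.subtype σ →ₗ[k] (G ⧸ H → A) :=
    (LinearMap.funLeft k A fun c : G ⧸ H ↦ c.out⁻¹) ∘ₗ (coindV H.subtype σ).subtype
  have hr : Function.Injective r := by
    rw [injective_iff_map_eq_zero]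
    intro f hf
    ext g
    obtain ⟨h, hh⟩ := QuotientGroup.mk_out_eq_mul H g⁻¹
    have hz : f.1 (Quotient.out (QuotientGroup.mk g⁻¹ : G ⧸ H))⁻¹ = 0 := congrFun hf _
    have hg : g = H.subtype h * (Quotient.out (QuotientGroup.mk g⁻¹ : G ⧸ H))⁻¹ := by simp [hh]
    have := f.2 h (Quotient.out (QuotientGroup.mk g⁻¹ : G ⧸ H))⁻¹
    rw [← hg, hz, map_zero] at this
    exact this
  refine (LinearMap.finrank_le_finrank_of_injective hr).trans_eq ?_
  rw [finrank_pi_fintype, Finset.sum_const, Finset.card_univ, smul_eq_mul, Subgroup.index,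
    Nat.card_eq_fintype_card]

/-- The one-dimensional representation on `k` attached to a linear character. -/
def ofLinearCharacter {G k : Type*} [Group G] [Field k] (χ : G →* kˣ) : Representation k G k :=
  (Algebra.lmul k k : k →* End k k).comp ((Units.coeHom k).comp χ)

end Representation

open Representation

/-- If `|G : H|` is at most every degree in `cd(G|N)`, then `N ≤ H`. -/
lemma le_of_index_le_of_mem_lowerBounds {G : Type} [Group G] [Finite G] {N : Subgroup G} {a : ℕ}
    (ha : a ∈ lowerBounds (cdOver G N)) {H : Subgroup G} (hH : H.index ≤ a) : N ≤ H := by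
  classical
  intro n hn
  by_contra hnH
  have := Fintype.ofFinite G
  let σ : Representation ℂ H ℂ := trivial ℂ H ℂ
  let s : coindV H.subtype σ →ₗ[ℂ] ℂ :=
    (Fintype.linearCombination ℂ (fun _ : G ↦ (1 : ℂ))) ∘ₗ (coindV H.subtype σ).subtype
  have hs (f : coindV H.subtype σ) : s f = ∑ g, f.1 g := by
    simp [s, Fintype.linearCombination_apply]
  have hs0 : s ≠ 0 := by
    intro h
    have h1 : s ⟨fun _ ↦ 1, fun _ _ ↦ rfl⟩ = 0 := by rw [h]; rfl
    rw [hs] at h1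
    simp at h1
  let K : Subrepresentation (coind H.subtype σ) :=
    { toSubmodule := LinearMap.ker s
      apply_mem_toSubmodule := fun g f hf ↦ by
        rw [LinearMap.mem_ker, hs] at hf ⊢
        rw [← hf]
        exact Equiv.sum_comp (Equiv.mulRight g) f.1 }
  have hK : Module.finrank ℂ K.toSubmodule < a := by
    have h1 := Module.Dual.finrank_ker_add_one_of_ne_zero (f := s) hs0
    have h2 := finrank_coindV_le H σ
    rw [Module.finrank_self, mul_one] at h2
    exact Nat.lt_of_succ_le ((h1.trans_le h2).trans hH)
  let f : coindV H.subtype σ :=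
    ⟨fun g ↦ (if g ∈ H then 1 else 0) - if g * n ∈ H then 1 else 0, fun h g ↦ by
      simp [σ, mul_assoc, H.mul_mem_cancel_left h.2]⟩
  have hf : f ∈ K.toSubmodule := by
    change s f = 0
    rw [hs, Finset.sum_sub_distrib, sub_eq_zero]
    exact (Equiv.sum_comp (Equiv.mulRight n) fun g ↦ if g ∈ H then (1 : ℂ) else 0).symm
  have hfix : f.1 (1 * n) = f.1 1 := congrArg (fun x : K.toSubmodule ↦ x.1.1 1)
    (apply_eq_self_of_finrank_lt ha K.toRepresentation hK hn ⟨f, hf⟩)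
  simp only [f, one_mul, hnH, one_mem, if_true, if_false] at hfix
  split_ifs at hfix <;> norm_num at hfix

/-- If `|G : H|` is smaller than every degree in `cd(G|N)`, then `N` lies in the kernel of every
linear character of `H`. -/
lemma linearCharacter_eq_one_of_index_lt {G : Type} [Group G] [Finite G] {N : Subgroup G} {a : ℕ}
    (ha : a ∈ lowerBounds (cdOver G N)) {H : Subgroup G} (hH : H.index < a) (χ : H →* ℂˣ)
    {n : H} (hn : (n : G) ∈ N) : χ n = 1 := by
  classical
  let f : coindV H.subtype (ofLinearCharacter χ) :=
    ⟨fun g ↦ if hg : g ∈ H then χ ⟨g, hg⟩ else 0, fun h g ↦ by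
      by_cases hg : g ∈ H
      · have hhg : (h : G) * g ∈ H := H.mul_mem h.2 hg
        have : (⟨h * g, hhg⟩ : H) = h * ⟨g, hg⟩ := rfl
        simp [ofLinearCharacter, hg, hhg, this]
      · simp [ofLinearCharacter, hg, H.mul_mem_cancel_left h.2]⟩
  have hlt : Module.finrank ℂ (coindV H.subtype (ofLinearCharacter χ)) < a := by
    have := finrank_coindV_le H (ofLinearCharacter χ)
    rw [Module.finrank_self, mul_one] at this
    exact this.trans_lt hH
  have hfix : f.1 (1 * n) = f.1 1 := congrArg (fun x : coindV H.subtype (ofLinearCharacter χ) ↦ x.1 1)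
    (apply_eq_self_of_finrank_lt ha (coind H.subtype (ofLinearCharacter χ)) hlt hn f)
  simp only [f, one_mul, n.2, one_mem, dif_pos] at hfix
  rw [Units.val_inj] at hfix
  exact hfix.trans (map_one χ)

/-- An element of a finite group on which all complex linear characters are trivial lies in the
derived subgroup. -/
lemma mem_commutator_of_forall_linearCharacter_eq_one {H : Type*} [Group H] [Finite H] {h : H}
    (hh : ∀ χ : H →* ℂˣ, χ h = 1) : h ∈ commutator H := by
  rw [← Abelianization.ker_of, MonoidHom.mem_ker]
  have : Finite (Abelianization H) := Quotient.finite _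
  have : NeZero ((Monoid.exponent (Abelianization H) : ℕ) : ℂ) :=
    ⟨Nat.cast_ne_zero.mpr Monoid.exponent_ne_zero_of_finite⟩
  by_contra hne
  obtain ⟨φ, hφ⟩ := CommGroup.exists_apply_ne_one_of_hasEnoughRootsOfUnity _ ℂ hne
  exact hφ (hh (φ.comp Abelianization.of))

/-- **Lemma 5.1.** Let `N ⊴ G` be nontrivial and `a = min cd(G|N)`.  If `H ≤ G` and
`|G:H| ≤ a` then `N ⊆ H`; if in fact `|G:H| < a` then `N ⊆ H'`. -/
theorem stmt10 (G : Type) [Group G] [Fintype G] (N : Subgroup G) [N.Normal]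
    (hN : N ≠ ⊥) (a : ℕ) (ha : IsLeast (cdOver G N) a) (H : Subgroup G) :
    (H.index ≤ a → N ≤ H) ∧ (H.index < a → N ≤ ⁅H, H⁆) := by
  refine ⟨le_of_index_le_of_mem_lowerBounds ha.2, fun hlt n hn ↦ ?_⟩
  have hnH : n ∈ H := le_of_index_le_of_mem_lowerBounds ha.2 hlt.le hn
  rw [← Subgroup.map_subtype_commutator]
  exact ⟨⟨n, hnH⟩, mem_commutator_of_forall_linearCharacter_eq_one fun χ ↦
    linearCharacter_eq_one_of_index_lt ha.2 hlt χ hn, rfl⟩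
end

section
/- Let G be a finite group, N a normal subgroup of G, and α ∈ Irr(N) an irreducible character of N that is invariant under the conjugation action of G. Let p be a prime that divides neither o(α) (the determinantal order of α) nor α(1). Then there exists γ ∈ Irr(G) lying over α (i.e., α is an irreducible constituent of the restriction of γ to N) such that p does not divide γ(1). -/
open CategoryTheory

/-- `γ ∈ Irr(G)` lies over `α ∈ Irr(H)` for `H ≤ G`: there is a nonzero `H`-equivariant
linear map from `α` to the restriction `γ_H`.  For simple `α` this says exactly that `α`
is an irreducible constituent of `γ_H`. -/
def LiesOver {G : Type} [Group G] (H : Subgroup G) (Γ : FDRep ℂ G)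
    (W : FDRep ℂ ↥H) : Prop :=
  ∃ f : W →ₗ[ℂ] Γ, f ≠ 0 ∧ ∀ (x : ↥H) (v : W), f (W.ρ x v) = Γ.ρ ↑x (f v)

/-- The determinantal order `o(α)` of a character `α` afforded by the representation `W`:
the order of the linear character `det ∘ ρ` of `H`. -/
noncomputable def detOrder {H : Type} [Group H] (W : FDRep ℂ H) : ℕ :=
  orderOf ((LinearMap.det : (W →ₗ[ℂ] W) →* ℂ).comp W.ρ)

theorem Subrepresentation.exists_le_isAtom_not_dvd_finrank {k G V : Type*} [Field k] [Group G]
    [AddCommGroup V] [Module k V] [FiniteDimensional k V] {ρ : Representation k G V}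
    [ρ.IsSemisimpleRepresentation] {p : ℕ} (U : Subrepresentation ρ)
    (hU : ¬ p ∣ Module.finrank k U.toSubmodule) :
    ∃ S ≤ U, IsAtom S ∧ ¬ p ∣ Module.finrank k S.toSubmodule := by
  induction hn : Module.finrank k U.toSubmodule using Nat.strong_induction_on generalizing U with
  | _ n ih =>
  by_cases hat : IsAtom U
  · exact ⟨U, le_rfl, hat, hU⟩
  have hbot : U ≠ ⊥ := by
    rintro rfl
    rw [show (⊥ : Subrepresentation ρ).toSubmodule = ⊥ from rfl, finrank_bot] at hU
    exact hU (dvd_zero p)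
  obtain ⟨X, hXbot, hXU⟩ : ∃ X : Subrepresentation ρ, X ≠ ⊥ ∧ X < U := by
    by_contra! h
    exact hat ⟨hbot, fun X hX => by_contra fun h' => h X h' hX⟩
  obtain ⟨Y, hY⟩ := exists_isCompl X
  have hle : X.toSubmodule ≤ U.toSubmodule := hXU.le
  have hsup : X.toSubmodule ⊔ Y.toSubmodule = ⊤ := congrArg toSubmodule hY.sup_eq_top
  have hinf : X.toSubmodule ⊓ Y.toSubmodule = ⊥ := congrArg toSubmodule hY.inf_eq_bot
  have hadd := Submodule.finrank_sup_add_finrank_inf_eq X.toSubmodule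
    (Y.toSubmodule ⊓ U.toSubmodule)
  rw [← sup_inf_assoc_of_le _ hle, hsup, top_inf_eq, ← inf_assoc, hinf, bot_inf_eq,
    finrank_bot, add_zero] at hadd
  have hXpos : 0 < Module.finrank k X.toSubmodule := by
    rw [Module.finrank_pos_iff, Submodule.nontrivial_iff_ne_bot]
    exact fun h => hXbot (toSubmodule_injective h)
  have hlt : Module.finrank k X.toSubmodule < Module.finrank k U.toSubmodule :=
    Submodule.finrank_lt_finrank_of_lt hXU
  by_cases hX : p ∣ Module.finrank k X.toSubmodule
  · obtain ⟨S, hS, h⟩ := ih _ (by simp only [toSubmodule_inf]; omega) (Y ⊓ U)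
      (fun h => hU (hadd ▸ dvd_add hX h)) rfl
    exact ⟨S, hS.trans inf_le_right, h⟩
  · obtain ⟨S, hS, h⟩ := ih _ (by omega) X hX rfl
    exact ⟨S, hS.trans hXU.le, h⟩

theorem Subrepresentation.isIrreducible_toRepresentation {k G V : Type*} [Field k] [Group G]
    [AddCommGroup V] [Module k V] {ρ : Representation k G V}
    {U : Subrepresentation ρ} (hU : IsAtom U) : U.toRepresentation.IsIrreducible := by
  have hne : U.toSubmodule ≠ ⊥ := fun h => hU.1 (toSubmodule_injective h)
  refine @IsSimpleOrder.mk _ _ _ ⟨⊥, ⊤, fun h => hne ?_⟩ fun S => ?_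
  · have h' : (⊥ : Submodule k U.toSubmodule) = ⊤ := congrArg toSubmodule h
    simpa using congrArg (Submodule.map U.toSubmodule.subtype) h'.symm
  · let T : Subrepresentation ρ :=
      ⟨S.toSubmodule.map U.toSubmodule.subtype, by
        rintro g _ ⟨v, hv, rfl⟩
        exact ⟨_, S.apply_mem_toSubmodule g hv, rfl⟩⟩
    have hT : T ≤ U :=
      Submodule.map_subtype_le _ _
    rcases hU.le_iff.1 hT with h | h
    · left
      apply toSubmodule_injective
      have := congrArg toSubmodule h
      exact Submodule.map_injective_of_injective U.toSubmodule.injective_subtype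
        (this.trans (Submodule.map_bot _).symm)
    · right
      apply toSubmodule_injective
      apply Submodule.map_injective_of_injective U.toSubmodule.injective_subtype
      rw [show (⊤ : Subrepresentation U.toRepresentation).toSubmodule = ⊤ from rfl,
        Submodule.map_subtype_top]
      exact congrArg toSubmodule h

theorem FDRep.simple_iff_finrank_intertwiningMap {k G : Type} [Field k] [IsAlgClosed k]
    [Group G] [Finite G] [NeZero (Nat.card G : k)] (V : FDRep k G) :
    Simple V ↔ Module.finrank k (Representation.IntertwiningMap V.ρ V.ρ) = 1 := by
  rw [FDRep.simple_iff_end_is_rank_one,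
    ← (Representation.linHom.invariantsEquivFDRepHom V V).finrank_eq,
    (Representation.invariantsEquivIntertwiningMap V.ρ V.ρ).finrank_eq]

theorem Representation.finrank_coindV_subtype {k G V : Type*} [Field k] [Group G] [Finite G]
    [AddCommGroup V] [Module k V] [FiniteDimensional k V] (P : Subgroup G)
    (σ : Representation k P V) :
    Module.finrank k (coindV P.subtype σ) = P.index * Module.finrank k V := by
  obtain ⟨T, hT, -⟩ := P.exists_isComplement_right 1
  let e : coindV P.subtype σ ≃ₗ[k] (T → V) :=
    { toFun f t := f.1 t
      map_add' _ _ := rfl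
      map_smul' _ _ := rfl
      invFun f := ⟨fun g => σ (hT.equiv g).1 (f (hT.equiv g).2), fun h g => by
        change σ (hT.equiv (h * g)).1 (f (hT.equiv (h * g)).2) = _
        rw [hT.equiv_mul_left]
        simp⟩
      left_inv f := by
        ext g
        change σ (hT.equiv g).1 (f.1 (hT.equiv g).2) = f.1 g
        rw [← f.2, Subgroup.coe_subtype, hT.equiv_fst_mul_equiv_snd]
      right_inv f := by
        ext t
        change σ (hT.equiv (t : G)).1 (f (hT.equiv (t : G)).2) = f t
        have ht : hT.equiv (t : G) = (1, t) := by
          rw [← Equiv.eq_symm_apply]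
          simp [Subgroup.IsComplement.equiv]
        simp [ht] }
  have : Fintype T := Fintype.ofFinite T
  rw [e.finrank_eq, Module.finrank_pi_fintype, Finset.sum_const, Finset.card_univ,
    Fintype.card_eq_nat_card, hT.card_right, smul_eq_mul]

namespace Representation
variable {G V : Type*} [Group G] [AddCommGroup V] [Module ℂ V] {N : Subgroup G} [N.Normal]

/-- The pairs `(g, T)` where `T` intertwines `ρ` with its conjugate by `g` and
`det T` is an `m`-th root of unity. -/
def conjIntertwiners (ρ : Representation ℂ N V) (m : ℕ) : Subgroup (G × (Module.End ℂ V)ˣ) where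
  carrier := {x | (∀ n, (x.2 : Module.End ℂ V) * ρ n = ρ (MulAut.conjNormal x.1 n) * x.2) ∧
    LinearMap.det (x.2 : Module.End ℂ V) ^ m = 1}
  one_mem' := by simp
  mul_mem' := by
    rintro ⟨g, T⟩ ⟨h, S⟩ ⟨hT, hT'⟩ ⟨hS, hS'⟩
    refine ⟨fun n => ?_, ?_⟩
    · simp only [Prod.mk_mul_mk, Units.val_mul, map_mul, MulAut.mul_apply] at hS hT ⊢
      rw [mul_assoc, hS, ← mul_assoc, hT, mul_assoc]
    · simp only [Prod.mk_mul_mk, Units.val_mul, map_mul, mul_pow] at hS' hT' ⊢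
      rw [hT', hS', one_mul]
  inv_mem' := by
    rintro ⟨g, T⟩ ⟨hT, hT'⟩
    refine ⟨fun n => ?_, ?_⟩
    · have := hT (MulAut.conjNormal g⁻¹ n)
      simp only [map_inv, MulAut.apply_inv_self, Prod.fst_inv, Prod.snd_inv] at this ⊢
      rw [Units.inv_mul_eq_iff_eq_mul, ← mul_assoc, this, mul_assoc, Units.mul_inv, mul_one]
    · simp [hT']

theorem exists_mem_conjIntertwiners (ρ : Representation ℂ N V) (m : ℕ)
    (hd : Module.finrank ℂ V ≠ 0) {g : G}
    (hg : ∃ T : (Module.End ℂ V)ˣ, ∀ n, (T : Module.End ℂ V) * ρ n =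
      ρ (MulAut.conjNormal g n) * T) :
    ∃ T, (g, T) ∈ conjIntertwiners ρ m := by
  obtain ⟨T, hT⟩ := hg
  have hdet : LinearMap.det (T : Module.End ℂ V) ≠ 0 := (T.isUnit.map LinearMap.det).ne_zero
  obtain ⟨c, hc⟩ := IsAlgClosed.exists_pow_nat_eq (LinearMap.det (T : Module.End ℂ V))⁻¹
    (Nat.pos_of_ne_zero hd)
  have hc0 : c ≠ 0 := by
    rintro rfl
    rw [zero_pow hd] at hc
    exact inv_ne_zero hdet hc.symm
  refine ⟨Units.mk0 c hc0 • T, fun n => ?_, ?_⟩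
  · simp [hT n, Units.smul_def]
  · simp [Units.smul_def, hc, hdet]

/-- Endomorphisms commuting with `ρ` are scalars if the endomorphism space is
one-dimensional. -/
theorem exists_eq_smul_one_of_commute {H : Type*} [Group H] [Nontrivial V]
    {ρ : Representation ℂ H V}
    (hρ : Module.finrank ℂ (IntertwiningMap ρ ρ) = 1) (T : Module.End ℂ V)
    (hT : ∀ h, T * ρ h = ρ h * T) : ∃ c : ℂ, T = c • 1 := by
  let one : IntertwiningMap ρ ρ := ⟨1, fun _ => rfl⟩
  have hone : one ≠ 0 := fun h => one_ne_zero (α := Module.End ℂ V)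
    (congrArg IntertwiningMap.toLinearMap h)
  obtain ⟨c, hc⟩ := (finrank_eq_one_iff_of_nonzero' one hone).1 hρ ⟨T, hT⟩
  exact ⟨c, (congrArg IntertwiningMap.toLinearMap hc).symm⟩

theorem exists_eq_smul_one_of_mem_conjIntertwiners [Nontrivial V] {ρ : Representation ℂ N V}
    (hρ : Module.finrank ℂ (IntertwiningMap ρ ρ) = 1) {m : ℕ} {T : (Module.End ℂ V)ˣ}
    (hT : ((1 : G), T) ∈ conjIntertwiners ρ m) :
    ∃ c : ℂ, (T : Module.End ℂ V) = c • 1 ∧ c ^ (Module.finrank ℂ V * m) = 1 := by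
  obtain ⟨c, hc⟩ := exists_eq_smul_one_of_commute hρ T (by simpa using hT.1)
  refine ⟨c, hc, ?_⟩
  simpa [hc, pow_mul] using hT.2

theorem finite_conjIntertwiners [Finite G] [Nontrivial V] [FiniteDimensional ℂ V]
    {ρ : Representation ℂ N V} (hρ : Module.finrank ℂ (IntertwiningMap ρ ρ) = 1)
    {m : ℕ} (hm : m ≠ 0) (hlift : ∀ g : G, ∃ T, (g, T) ∈ conjIntertwiners ρ m) :
    Finite (conjIntertwiners ρ m) := by
  choose T hT using hlift
  have : NeZero (Module.finrank ℂ V * m) := ⟨mul_ne_zero Module.finrank_pos.ne' hm⟩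
  let f : G × rootsOfUnity (Module.finrank ℂ V * m) ℂ → G × (Module.End ℂ V)ˣ :=
    fun x => (x.1, (x.2 : ℂˣ) • T x.1)
  refine Set.Finite.subset (Set.finite_range f) ?_
  rintro ⟨g, S⟩ hS
  have h1 : ((1 : G), S * (T g)⁻¹) ∈ conjIntertwiners ρ m := by
    simpa using mul_mem hS (inv_mem (hT g))
  obtain ⟨c, hc, hc1⟩ := exists_eq_smul_one_of_mem_conjIntertwiners hρ h1
  refine ⟨(g, rootsOfUnity.mkOfPowEq c hc1), ?_⟩
  refine Prod.ext rfl (Units.ext ?_)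
  rw [Units.val_mul, Units.mul_inv_eq_iff_eq_mul] at hc
  simp [f, hc, Units.smul_def]

/-- If an invariant representation of a normal subgroup has degree and determinantal order
prime to `p`, then it extends to a subgroup of index prime to `p`. -/
theorem exists_extension_of_not_dvd [Finite G] [FiniteDimensional ℂ V]
    (ρ : Representation ℂ N V) (hρ : Module.finrank ℂ (IntertwiningMap ρ ρ) = 1)
    (hconj : ∀ g : G, ∃ T : (Module.End ℂ V)ˣ, ∀ n, (T : Module.End ℂ V) * ρ n =
      ρ (MulAut.conjNormal g n) * T)
    {p m : ℕ} (hp : p.Prime) (hm : ¬ p ∣ m) (hdet : ∀ n, LinearMap.det (ρ n) ^ m = 1)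
    (hd : ¬ p ∣ Module.finrank ℂ V) :
    ∃ (P : Subgroup G) (hNP : N ≤ P) (σ : Representation ℂ P V),
      ¬ p ∣ P.index ∧ ∀ n, σ (Subgroup.inclusion hNP n) = ρ n := by
  have : Fact p.Prime := ⟨hp⟩
  have hm0 : m ≠ 0 := by rintro rfl; exact hm (dvd_zero p)
  have hd0 : Module.finrank ℂ V ≠ 0 := fun h => hd (h ▸ dvd_zero p)
  have : Nontrivial V := Module.nontrivial_of_finrank_pos (Nat.pos_of_ne_zero hd0)
  have hlift g := exists_mem_conjIntertwiners ρ m hd0 (hconj g)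
  have := finite_conjIntertwiners hρ hm0 hlift
  let fst : conjIntertwiners ρ m →* G := (MonoidHom.fst _ _).comp (Subgroup.subtype _)
  have hfst : Function.Surjective fst := fun g => (hlift g).elim fun T hT => ⟨⟨_, hT⟩, rfl⟩
  let ι : N →* conjIntertwiners ρ m := (N.subtype.prod ρ.toHomUnits).codRestrict _ fun n =>
    ⟨fun x => by
      have : n * x = MulAut.conjNormal (n : G) x * n := Subtype.ext (by simp)
      change ρ n * ρ x = ρ _ * ρ n
      rw [← map_mul, ← map_mul]
      exact congrArg ρ this, hdet n⟩
  have hι : ι.range.Normal := by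
    refine ⟨?_⟩
    rintro _ ⟨n, rfl⟩ x
    refine ⟨MulAut.conjNormal x.1.1 n, Subtype.ext (Prod.ext (MulAut.conjNormal_apply x.1.1 n)
      (Units.ext ?_))⟩
    change ρ _ = x.1.2.1 * ρ n * (x.1.2⁻¹).1
    rw [Units.eq_mul_inv_iff_mul_eq, x.2.1 n]
  obtain ⟨Q⟩ : Nonempty (Sylow p (conjIntertwiners ρ m)) := inferInstance
  let H := ι.range ⊔ (Q : Subgroup (conjIntertwiners ρ m))
  let f : H →* G := fst.comp H.subtype
  have hf : Function.Injective f := by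
    rw [injective_iff_map_eq_one]
    rintro ⟨z, hz⟩ hz1
    replace hz1 : z.1.1 = 1 := hz1
    obtain ⟨a, ha⟩ : ∃ a : ℕ, z ^ p ^ a ∈ ι.range := by
      obtain ⟨x, hx, q, hq, rfl⟩ := Subgroup.mem_sup_of_normal_left.1 hz
      obtain ⟨a, ha⟩ := Q.isPGroup' ⟨q, hq⟩
      refine ⟨a, ?_⟩
      rw [← QuotientGroup.eq_one_iff, QuotientGroup.mk_pow, QuotientGroup.mk_mul,
        (QuotientGroup.eq_one_iff x).2 hx, one_mul, ← QuotientGroup.mk_pow,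
        show q ^ p ^ a = 1 from congrArg Subtype.val ha, QuotientGroup.mk_one]
    have hpa : z ^ p ^ a = 1 := by
      obtain ⟨n, hn⟩ := ha
      have hn1 : n = 1 := Subtype.ext (by
        have := congrArg fst hn
        rw [map_pow, show fst z = 1 from hz1, one_pow] at this
        exact this)
      rw [← hn, hn1, map_one]
    have hroot : z ^ (Module.finrank ℂ V * m) = 1 := by
      obtain ⟨⟨g, T⟩, hT⟩ := z
      obtain rfl : g = 1 := hz1
      obtain ⟨c, hc, hc1⟩ := exists_eq_smul_one_of_mem_conjIntertwiners hρ hT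
      refine Subtype.ext (Prod.ext (one_pow _) (Units.ext ?_))
      simp [hc, hc1, smul_pow]
    have hco : Nat.Coprime (p ^ a) (Module.finrank ℂ V * m) :=
      ((Nat.Prime.coprime_iff_not_dvd hp).2 (hp.not_dvd_mul hd hm)).pow_left a
    refine Subtype.ext (orderOf_eq_one_iff.1 (Nat.eq_one_of_dvd_coprimes hco ?_ ?_))
    · exact orderOf_dvd_of_pow_eq_one hpa
    · exact orderOf_dvd_of_pow_eq_one hroot
  let e := MonoidHom.ofInjective hf
  let snd : H →* Module.End ℂ V :=
    (Units.coeHom _).comp ((MonoidHom.snd _ _).comp ((Subgroup.subtype _).comp H.subtype))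
  have hιH n : ι n ∈ H := Subgroup.mem_sup_left ⟨n, rfl⟩
  have hNP : N ≤ f.range := fun n hn => ⟨⟨ι ⟨n, hn⟩, hιH _⟩, rfl⟩
  refine ⟨f.range, hNP, snd.comp e.symm.toMonoidHom, ?_, fun n => ?_⟩
  · have hrange : f.range = H.map fst := by
      rw [MonoidHom.range_comp, Subgroup.range_subtype]
    rw [hrange]
    exact fun h => Q.not_dvd_index
      ((h.trans (Subgroup.index_map_dvd H hfst)).trans (Subgroup.index_dvd_of_le le_sup_right))
  · have : e.symm (Subgroup.inclusion hNP n) = ⟨ι n, hιH n⟩ := by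
      rw [MulEquiv.symm_apply_eq]
      rfl
    change snd (e.symm _) = _
    rw [this]
    rfl

/-- Over a finite group in characteristic zero, nonzero intertwining maps can be reversed. -/
theorem exists_intertwiningMap_ne_zero_symm {k G V W : Type*} [Field k] [CharZero k] [Group G]
    [Finite G] [AddCommGroup V] [Module k V] [FiniteDimensional k V] [AddCommGroup W] [Module k W]
    [FiniteDimensional k W] {ρ : Representation k G V} {σ : Representation k G W}
    (f : IntertwiningMap ρ σ) (hf : f ≠ 0) : ∃ g : IntertwiningMap σ ρ, g ≠ 0 := by
  have := Fintype.ofFinite G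
  have := invertibleOfNonzero (NeZero.ne (Nat.card G : k))
  have hsymm : Module.finrank k (IntertwiningMap ρ σ) = Module.finrank k (IntertwiningMap σ ρ) := by
    rw [← Nat.cast_inj (R := k), ← card_inv_mul_sum_char_mul_char_eq_finrank,
      ← card_inv_mul_sum_char_mul_char_eq_finrank, ← Equiv.sum_comp (Equiv.inv G)]
    simp [mul_comm]
  have : FiniteDimensional k (IntertwiningMap ρ σ) :=
    (invariantsEquivIntertwiningMap ρ σ).finiteDimensional
  have : Nontrivial (IntertwiningMap ρ σ) := ⟨f, 0, hf⟩
  have hpos := Module.finrank_pos (R := k) (M := IntertwiningMap ρ σ)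
  have := Module.nontrivial_of_finrank_pos (hsymm ▸ hpos)
  exact exists_ne 0

end Representation

/-- A simple representation of a normal subgroup whose character is invariant is isomorphic to
its conjugates. -/
theorem FDRep.exists_intertwiner_of_character_conj {G : Type} [Group G] [Finite G]
    {N : Subgroup G} [N.Normal] (W : FDRep ℂ N) [Simple W] (g : G)
    (hinv : ∀ x, W.character (MulAut.conjNormal g x) = W.character x) :
    ∃ T : (Module.End ℂ W)ˣ, ∀ x, (T : Module.End ℂ W) * W.ρ x =
      W.ρ (MulAut.conjNormal g x) * T := by
  have := Fintype.ofFinite N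
  have := invertibleOfNonzero (NeZero.ne (Nat.card N : ℂ))
  let W' : FDRep ℂ N :=
    FDRep.of (V := W) ((W.ρ).comp (MulAut.conjNormal g : MulAut N).toMonoidHom)
  have hchar : W'.character = W.character := funext hinv
  have hW' : Simple W' := by
    rw [FDRep.simple_iff_char_is_norm_one, hchar, ← FDRep.simple_iff_char_is_norm_one]
    infer_instance
  obtain ⟨i⟩ : Nonempty (W ≅ W') := by
    by_contra h
    have h' := FDRep.char_orthonormal W W'
    rw [hchar, FDRep.char_orthonormal W W, if_pos ⟨Iso.refl W⟩, if_neg h] at h'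
    exact one_ne_zero h'
  let e : W ≃ₗ[ℂ] W := FDRep.isoToLinearEquiv (V := W) (W := W') i
  refine ⟨LinearMap.GeneralLinearGroup.ofLinearEquiv e, fun x => ?_⟩
  have h : W.ρ (MulAut.conjNormal g x) = e.conj (W.ρ x) := FDRep.Iso.conj_ρ i x
  ext v
  simp [h, LinearEquiv.conj_apply]

/-- **Lemma 5.2.** Let `N ⊴ G` and let `α ∈ Irr(N)` (formalized by a simple
`W : FDRep ℂ ↥N`) be invariant in `G`.  If the prime `p` divides neither the
determinantal order `o(α)` nor `α(1)`, then there exists `γ ∈ Irr(G)` lying over `α`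
whose degree is not divisible by `p`. -/
theorem stmt11 (G : Type) [Group G] [Fintype G] (N : Subgroup G) [N.Normal]
    (W : FDRep ℂ ↥N) (hW : Simple W)
    (hinv : ∀ (g : G) (x : ↥N) (hgx : g * ↑x * g⁻¹ ∈ N),
      W.character ⟨g * ↑x * g⁻¹, hgx⟩ = W.character x)
    (p : ℕ) (hp : p.Prime)
    (hdet : ¬ p ∣ detOrder W) (hdeg : ¬ p ∣ Module.finrank ℂ W) :
    ∃ Γ : FDRep ℂ G, Simple Γ ∧ LiesOver N Γ W ∧ ¬ p ∣ Module.finrank ℂ Γ := by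
  have : Simple W := hW
  obtain ⟨P, hNP, σ, hP, hσ⟩ := Representation.exists_extension_of_not_dvd W.ρ
    ((FDRep.simple_iff_finrank_intertwiningMap W).1 hW)
    (fun g => FDRep.exists_intertwiner_of_character_conj W g fun x => hinv g x _)
    hp hdet (fun n => DFunLike.congr_fun (pow_orderOf_eq_one
      ((LinearMap.det : (W →ₗ[ℂ] W) →* ℂ).comp W.ρ)) n) hdeg
  let τ := Representation.coind P.subtype σ
  obtain ⟨S, -, hS, hSp⟩ := (⊤ : Subrepresentation τ).exists_le_isAtom_not_dvd_finrank
    (p := p) (by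
    change ¬ p ∣ Module.finrank ℂ (⊤ : Submodule ℂ (Representation.coindV P.subtype σ))
    rw [finrank_top, Representation.finrank_coindV_subtype]
    exact hp.not_dvd_mul hP hdeg)
  have hirr := S.isIrreducible_toRepresentation hS
  refine ⟨FDRep.of (V := S.toSubmodule) S.toRepresentation, ?_, ?_, hSp⟩
  · rw [FDRep.simple_iff_finrank_intertwiningMap]
    exact Representation.IsIrreducible.finrank_intertwiningMap_self (V := S.toSubmodule)
      S.toRepresentation
  · let f : Representation.IntertwiningMap (S.toRepresentation.comp N.subtype) W.ρ :=
      { toFun v := v.1.1 1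
        map_add' _ _ := rfl
        map_smul' _ _ := rfl
        isIntertwining' n := by
          ext v
          change v.1.1 (1 * n) = W.ρ n (v.1.1 1)
          rw [← hσ, ← v.1.2]
          simp }
    have hf : f ≠ 0 := by
      intro hf
      refine hS.1 (Subrepresentation.toSubmodule_injective ((Submodule.eq_bot_iff _).2 ?_))
      intro v hv
      ext g
      have : v.1 (1 * g) = 0 :=
        congrArg (fun f => f ⟨τ g v, S.apply_mem_toSubmodule g hv⟩) hf
      simpa using this
    obtain ⟨e, he⟩ := Representation.exists_intertwiningMap_ne_zero_symm
      (V := S.toSubmodule) (ρ := S.toRepresentation.comp N.subtype) f hf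
    refine ⟨e.toLinearMap, fun h => he (Representation.IntertwiningMap.toLinearMap_injective _ _ h),
      fun x v => LinearMap.congr_fun (e.isIntertwining' x) v⟩
end
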